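/- arXiv:1202.2406 — 8 statements merged into one kernel-verified Lean document; each statement's English description precedes it below -/
import Mathlib

section
/- Let Ψ : (0,1] → (0,∞) be decreasing such that s ↦ sΨ(s) is increasing on (0,1]. Let Φ be a differentiable Young function, and suppose there are constants C₀ > 0 and t₀ > 0 such that for all t ≥ t₀ one has 1/(Φ(t)Φ'(t)) ∈ (0,1] and Ψ(1/(Φ(t)Φ'(t))) ≤ C₀·Φ'(t). Then there is a constant C = C(Φ, Ψ, C₀) such that for every interval I ⊂ ℝ of finite positive length and every nonnegative measurable function w on ℝ, n_Ψ(N_I^w) := ∫₀^∞ N_I^w(t)·Ψ(N_I^w(t)) dt ≤ C·‖w‖_{L^Φ(I)} (the integrand taken to be 0 where N_I^w(t) = 0). -/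
open MeasureTheory

/-- The normalized distribution function `N_I^w(t) = |{x ∈ I : w(x) > t}|/|I|` of `w`
on the interval `I = (a, b)`. -/
noncomputable def distFun (a b : ℝ) (w : ℝ → ℝ) (t : ℝ) : ℝ :=
  (volume {x ∈ Set.Ioo a b | t < w x}).toReal / (b - a)

/-- `n_Ψ(N) = ∫₀^∞ N(t)Ψ(N(t)) dt` as an extended-real-valued (lower) integral,
with the integrand taken to be `0` where `N(t) = 0`. -/
noncomputable def nPsiE (Ψ N : ℝ → ℝ) : ENNReal :=
  ∫⁻ t in Set.Ioi (0:ℝ), ENNReal.ofReal (if N t = 0 then 0 else N t * Ψ (N t))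

/-- The integrand `N(t)Ψ(N(t))` of `nPsiE`, with value `0` where `N` vanishes. -/
noncomputable def psiWeight (Ψ : ℝ → ℝ) (x : ℝ) : ℝ := if x = 0 then 0 else x * Ψ x

/-- The part of `[t₀, ∞)` on which `g` takes values in `[m 2^i, m 2^(i+1))`. -/
def dyadicLevel (g : ℝ → ℝ) (t₀ m : ℝ) (i : ℕ) : Set ℝ :=
  {t | t₀ ≤ t ∧ m * 2 ^ i ≤ g t ∧ g t < m * 2 ^ (i + 1)}

theorem measurableSet_dyadicLevel {g : ℝ → ℝ} {t₀ : ℝ} (hg : MonotoneOn g (Set.Ici t₀))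
    (m : ℝ) (i : ℕ) : MeasurableSet (dyadicLevel g t₀ m i) := by
  apply Set.OrdConnected.measurableSet
  refine ⟨fun x hx y hy z hz => ?_⟩
  have hz0 : t₀ ≤ z := hx.1.trans hz.1
  exact ⟨hz0, hx.2.1.trans (hg hx.1 hz0 hz.1), (hg hz0 hy.1 hz.2).trans_lt hy.2.2⟩

theorem exists_mem_dyadicLevel {g : ℝ → ℝ} {t₀ t : ℝ} (hg : MonotoneOn g (Set.Ici t₀))
    (hpos : 0 < g t₀) (ht : t₀ ≤ t) : ∃ i, t ∈ dyadicLevel g t₀ (g t₀) i := by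
  have h1 : 1 ≤ g t / g t₀ := (one_le_div hpos).2 (hg Set.self_mem_Ici ht ht)
  obtain ⟨i, hi, hi'⟩ := exists_nat_pow_near h1 one_lt_two
  refine ⟨i, ht, ?_, ?_⟩
  · rwa [le_div_iff₀ hpos, mul_comm] at hi
  · rwa [div_lt_iff₀ hpos, mul_comm] at hi'

theorem psiWeight_le_mul {Ψ : ℝ → ℝ} (hΨpos : ∀ s ∈ Set.Ioc (0:ℝ) 1, 0 < Ψ s)
    (hφinc : MonotoneOn (fun s => s * Ψ s) (Set.Ioc (0:ℝ) 1)) {x y : ℝ}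
    (hx0 : 0 ≤ x) (hxy : x ≤ y) (hy : y ∈ Set.Ioc (0:ℝ) 1) : psiWeight Ψ x ≤ y * Ψ y := by
  unfold psiWeight
  split_ifs with h
  · exact (mul_pos hy.1 (hΨpos y hy)).le
  · exact hφinc ⟨lt_of_le_of_ne hx0 (Ne.symm h), hxy.trans hy.2⟩ hy hxy

/-- On a dyadic level set `E` of `Φ'`, either `NΨ(N)` is controlled by `NΦ'`, or it is bounded by
the reciprocal of the length of `E`. -/
theorem psiWeight_dichotomy {Ψ : ℝ → ℝ}
    (hΨpos : ∀ s ∈ Set.Ioc (0:ℝ) 1, 0 < Ψ s)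
    (hΨdec : AntitoneOn Ψ (Set.Ioc (0:ℝ) 1))
    (hφinc : MonotoneOn (fun s => s * Ψ s) (Set.Ioc (0:ℝ) 1))
    {Φ Φ' : ℝ → ℝ} {C₀ t₀ m : ℝ} (hC₀ : 0 < C₀) (hm : 0 < m)
    (hΦnonneg : ∀ t, t₀ ≤ t → 0 ≤ Φ t)
    (hslope : ∀ x y, t₀ ≤ x → x < y → Φ' x * (y - x) ≤ Φ y - Φ x)
    (hdom : ∀ t, t₀ ≤ t → (Φ t * Φ' t)⁻¹ ∈ Set.Ioc (0:ℝ) 1)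
    (hΨΦ : ∀ t, t₀ ≤ t → Ψ ((Φ t * Φ' t)⁻¹) ≤ C₀ * Φ' t)
    {i : ℕ} {s x : ℝ} (hs : s ∈ dyadicLevel Φ' t₀ m i) (hx0 : 0 ≤ x) (hx1 : x ≤ 1) :
    psiWeight Ψ x ≤ 2 * C₀ * (x * Φ' s) ∨
      ∀ σ ∈ dyadicLevel Φ' t₀ m i, ∀ τ ∈ dyadicLevel Φ' t₀ m i,
        psiWeight Ψ x * |τ - σ| ≤ C₀ / (m * 2 ^ i) := by
  by_cases h : ∃ τ ∈ dyadicLevel Φ' t₀ m i, (Φ τ * Φ' τ)⁻¹ ≤ x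
  · left
    obtain ⟨τ, hτ, hle⟩ := h
    have hF := hdom τ hτ.1
    have hx : 0 < x := hF.1.trans_le hle
    have h1 : Ψ x ≤ C₀ * Φ' τ := (hΨdec hF ⟨hx, hx1⟩ hle).trans (hΨΦ τ hτ.1)
    have h2 : Φ' τ ≤ 2 * Φ' s := by
      have := hτ.2.2
      have := hs.2.1
      rw [pow_succ] at *
      linarith
    have h3 : Ψ x ≤ C₀ * (2 * Φ' s) := h1.trans (by gcongr)
    rw [psiWeight, if_neg hx.ne']
    calc x * Ψ x ≤ x * (C₀ * (2 * Φ' s)) := by gcongr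
      _ = _ := by ring
  · right
    push Not at h
    have hM : 0 < m * 2 ^ i := by positivity
    have key : ∀ σ ∈ dyadicLevel Φ' t₀ m i, ∀ τ ∈ dyadicLevel Φ' t₀ m i, σ < τ →
        psiWeight Ψ x * (τ - σ) ≤ C₀ / (m * 2 ^ i) := by
      intro σ hσ τ hτ hlt
      have hF := hdom τ hτ.1
      have hΦ'pos : 0 < Φ' τ := hM.trans_le hτ.2.1
      have hΦpos : 0 < Φ τ := pos_of_mul_pos_left (inv_pos.1 hF.1) hΦ'pos.le
      have h1 : psiWeight Ψ x ≤ C₀ / Φ τ :=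
        calc psiWeight Ψ x ≤ (Φ τ * Φ' τ)⁻¹ * Ψ ((Φ τ * Φ' τ)⁻¹) :=
              psiWeight_le_mul hΨpos hφinc hx0 (h τ hτ).le hF
          _ ≤ (Φ τ * Φ' τ)⁻¹ * (C₀ * Φ' τ) :=
              mul_le_mul_of_nonneg_left (hΨΦ τ hτ.1) hF.1.le
          _ = C₀ / Φ τ := by field_simp
      have h2 : m * 2 ^ i * (τ - σ) ≤ Φ τ := by
        have h3 := hslope σ τ hσ.1 hlt
        have h4 := hΦnonneg σ hσ.1
        have h5 := mul_le_mul_of_nonneg_right hσ.2.1 (sub_pos.2 hlt).le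
        linarith
      calc psiWeight Ψ x * (τ - σ) ≤ C₀ / Φ τ * (τ - σ) :=
            mul_le_mul_of_nonneg_right h1 (sub_pos.2 hlt).le
        _ ≤ C₀ / (m * 2 ^ i) := by
            rw [div_mul_eq_mul_div, div_le_div_iff₀ hΦpos hM]
            calc C₀ * (τ - σ) * (m * 2 ^ i) = C₀ * (m * 2 ^ i * (τ - σ)) := by ring
              _ ≤ _ := by gcongr
    intro σ hσ τ hτ
    rcases lt_trichotomy σ τ with hlt | rfl | hlt
    · rw [abs_of_pos (sub_pos.2 hlt)]
      exact key σ hσ τ hτ hlt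
    · simp only [sub_self, abs_zero, mul_zero]
      positivity
    · rw [abs_sub_comm, abs_of_pos (sub_pos.2 hlt)]
      exact key τ hτ σ hσ hlt

theorem ofReal_le_div_volume {E : Set ℝ} {r c : ℝ} (hc : 0 < c)
    (h : ∀ σ ∈ E, ∀ τ ∈ E, r * |τ - σ| ≤ c) :
    ENNReal.ofReal r ≤ ENNReal.ofReal c / volume E := by
  have hc' : ENNReal.ofReal c ≠ 0 := by simpa using hc
  have hdiam : volume E ≤ ENNReal.ofReal c / ENNReal.ofReal r := by
    refine (Real.volume_le_diam E).trans (Metric.ediam_le fun σ hσ τ hτ => ?_)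
    rw [ENNReal.le_div_iff_mul_le (Or.inr hc') (Or.inr ENNReal.ofReal_ne_top), edist_dist,
      ← ENNReal.ofReal_mul dist_nonneg, dist_comm, Real.dist_eq, mul_comm]
    exact ENNReal.ofReal_le_ofReal (h σ hσ τ hτ)
  rw [ENNReal.le_div_iff_mul_le (Or.inr hc') (Or.inr ENNReal.ofReal_ne_top)] at hdiam ⊢
  rwa [mul_comm]

theorem lintegral_psiWeight_le {Ψ : ℝ → ℝ}
    (hΨpos : ∀ s ∈ Set.Ioc (0:ℝ) 1, 0 < Ψ s)
    (hΨdec : AntitoneOn Ψ (Set.Ioc (0:ℝ) 1))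
    (hφinc : MonotoneOn (fun s => s * Ψ s) (Set.Ioc (0:ℝ) 1))
    {Φ Φ' : ℝ → ℝ} {C₀ t₀ : ℝ} (hC₀ : 0 < C₀) (ht₀ : 0 < t₀)
    (hm : 0 < Φ' t₀) (hΦ'mono : MonotoneOn Φ' (Set.Ici t₀))
    (hΦnonneg : ∀ t, t₀ ≤ t → 0 ≤ Φ t)
    (hslope : ∀ x y, t₀ ≤ x → x < y → Φ' x * (y - x) ≤ Φ y - Φ x)
    (hdom : ∀ t, t₀ ≤ t → (Φ t * Φ' t)⁻¹ ∈ Set.Ioc (0:ℝ) 1)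
    (hΨΦ : ∀ t, t₀ ≤ t → Ψ ((Φ t * Φ' t)⁻¹) ≤ C₀ * Φ' t)
    {N : ℝ → ℝ} (hN0 : ∀ t, 0 ≤ N t) (hN1 : ∀ t, N t ≤ 1)
    (hN : ∫⁻ t in Set.Ioi (0:ℝ), ENNReal.ofReal (N t * Φ' t) ≤ 1) :
    ∫⁻ t in Set.Ioi (0:ℝ), ENNReal.ofReal (psiWeight Ψ (N t)) ≤
      ENNReal.ofReal (Ψ 1 * t₀ + 2 * C₀ / Φ' t₀ + 2 * C₀) := by
  set m := Φ' t₀ with hm_def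
  have h11 : (1:ℝ) ∈ Set.Ioc (0:ℝ) 1 := ⟨one_pos, le_rfl⟩
  have hΨ1 := hΨpos 1 h11
  let c : ℕ → ENNReal := fun i => ENNReal.ofReal (C₀ / (m * 2 ^ i))
  let A : ℝ → ENNReal := (Set.Ioc 0 t₀).indicator fun _ => ENNReal.ofReal (Ψ 1)
  let B : ℕ → ℝ → ENNReal := fun i =>
    (dyadicLevel Φ' t₀ m i).indicator fun _ => c i / volume (dyadicLevel Φ' t₀ m i)
  have hA : Measurable A := measurable_const.indicator measurableSet_Ioc
  have hB : ∀ i, Measurable (B i) := fun i =>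
    measurable_const.indicator (measurableSet_dyadicLevel hΦ'mono m i)
  have hpt : ∀ t ∈ Set.Ioi (0:ℝ), ENNReal.ofReal (psiWeight Ψ (N t)) ≤
      A t + ∑' i, B i t + ENNReal.ofReal (2 * C₀) * ENNReal.ofReal (N t * Φ' t) := by
    intro t ht
    rcases le_or_gt t t₀ with htt | htt
    · refine le_add_right (le_add_right ?_)
      have : A t = ENNReal.ofReal (Ψ 1) := Set.indicator_of_mem (s := Set.Ioc 0 t₀) ⟨ht, htt⟩ _
      rw [this]
      apply ENNReal.ofReal_le_ofReal
      simpa using psiWeight_le_mul hΨpos hφinc (hN0 t) (hN1 t) h11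
    · obtain ⟨i, hi⟩ := exists_mem_dyadicLevel hΦ'mono hm htt.le
      rcases psiWeight_dichotomy hΨpos hΨdec hφinc hC₀ hm hΦnonneg hslope hdom hΨΦ hi
        (hN0 t) (hN1 t) with h | h
      · refine le_add_left ?_
        rw [← ENNReal.ofReal_mul (by positivity)]
        exact ENNReal.ofReal_le_ofReal h
      · refine le_add_right (le_add_left (le_trans ?_ (ENNReal.le_tsum i)))
        have : B i t = c i / volume (dyadicLevel Φ' t₀ m i) :=
          Set.indicator_of_mem (s := dyadicLevel Φ' t₀ m i) hi _
        rw [this]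
        exact ofReal_le_div_volume (by positivity) h
  have hAint : ∫⁻ t in Set.Ioi (0:ℝ), A t ≤ ENNReal.ofReal (Ψ 1 * t₀) := by
    refine (setLIntegral_le_lintegral _ _).trans ?_
    rw [lintegral_indicator_const measurableSet_Ioc, Real.volume_Ioc, sub_zero,
      ← ENNReal.ofReal_mul hΨ1.le]
  have hBint : ∀ i, ∫⁻ t in Set.Ioi (0:ℝ), B i t ≤ c i := by
    intro i
    refine (setLIntegral_le_lintegral _ _).trans ?_
    rw [lintegral_indicator_const (measurableSet_dyadicLevel hΦ'mono m i), div_eq_mul_inv,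
      mul_assoc]
    exact mul_le_of_le_one_right' (ENNReal.inv_mul_le_one _)
  have hc : ∑' i, c i = ENNReal.ofReal (2 * C₀ / m) := by
    have hci : c = fun i : ℕ => ENNReal.ofReal (2 * C₀ / m / 2 / 2 ^ i) := by
      funext i
      simp only [c]
      congr 1
      field_simp
    rw [hci, ← ENNReal.ofReal_tsum_of_nonneg (fun i => by positivity) (summable_geometric_two' _),
      tsum_geometric_two']
  calc ∫⁻ t in Set.Ioi (0:ℝ), ENNReal.ofReal (psiWeight Ψ (N t))
      ≤ ∫⁻ t in Set.Ioi (0:ℝ), (A t + ∑' i, B i t +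
          ENNReal.ofReal (2 * C₀) * ENNReal.ofReal (N t * Φ' t)) :=
        setLIntegral_mono' measurableSet_Ioi hpt
    _ = (∫⁻ t in Set.Ioi (0:ℝ), A t) + (∑' i, ∫⁻ t in Set.Ioi (0:ℝ), B i t) +
          ENNReal.ofReal (2 * C₀) * ∫⁻ t in Set.Ioi (0:ℝ), ENNReal.ofReal (N t * Φ' t) := by
        have hAB : Measurable fun t => A t + ∑' i, B i t := hA.add (Measurable.tsum hB)
        rw [lintegral_add_left hAB, lintegral_add_left hA,
          lintegral_tsum fun i => (hB i).aemeasurable,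
          lintegral_const_mul' _ _ ENNReal.ofReal_ne_top]
    _ ≤ ENNReal.ofReal (Ψ 1 * t₀) + ENNReal.ofReal (2 * C₀ / m) + ENNReal.ofReal (2 * C₀) * 1 := by
        rw [← hc]
        gcongr
        exact hBint _
    _ = _ := by
        rw [mul_one, ← ENNReal.ofReal_add (by positivity) (by positivity),
          ← ENNReal.ofReal_add (by positivity) (by positivity)]

theorem lintegral_Ioi_zero_eq_mul_lintegral_comp_mul (f : ℝ → ENNReal) {lam : ℝ}
    (hlam : 0 < lam) :
    ∫⁻ t in Set.Ioi (0:ℝ), f t =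
      ENNReal.ofReal lam * ∫⁻ t in Set.Ioi (0:ℝ), f (lam * t) := by
  have h1 := Real.smul_map_volume_mul_left hlam.ne'
  have h2 : (fun t => (Set.Ioi (0:ℝ)).indicator f (lam * t)) =
      (Set.Ioi (0:ℝ)).indicator fun t => f (lam * t) := by
    funext t
    simp [Set.indicator_apply, hlam]
  have h3 := lintegral_map_equiv (μ := volume) ((Set.Ioi (0:ℝ)).indicator f)
    (MeasurableEquiv.mulLeft₀ lam hlam.ne')
  simp only [MeasurableEquiv.coe_mulLeft₀] at h3
  rw [← lintegral_indicator measurableSet_Ioi, ← lintegral_indicator measurableSet_Ioi, ← h2, ← h3]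
  conv_lhs => rw [← h1]
  rw [lintegral_smul_measure, abs_of_pos hlam, smul_eq_mul]

theorem nPsiE_distFun_eq_mul (Ψ w : ℝ → ℝ) (a b : ℝ) {lam : ℝ} (hlam : 0 < lam) :
    nPsiE Ψ (distFun a b w) =
      ENNReal.ofReal lam * nPsiE Ψ (distFun a b fun x => w x / lam) := by
  have h : ∀ t, distFun a b w (lam * t) = distFun a b (fun x => w x / lam) t := by
    intro t
    simp only [distFun, lt_div_iff₀ hlam, mul_comm]
  unfold nPsiE
  rw [lintegral_Ioi_zero_eq_mul_lintegral_comp_mul _ hlam]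
  simp only [h]

theorem distFun_nonneg {a b : ℝ} (hab : a < b) (w : ℝ → ℝ) (t : ℝ) : 0 ≤ distFun a b w t :=
  div_nonneg ENNReal.toReal_nonneg (sub_pos.2 hab).le

theorem distFun_le_one {a b : ℝ} (hab : a < b) (w : ℝ → ℝ) (t : ℝ) : distFun a b w t ≤ 1 := by
  rw [distFun, div_le_one (sub_pos.2 hab)]
  have h : volume {x ∈ Set.Ioo a b | t < w x} ≤ ENNReal.ofReal (b - a) :=
    (measure_mono (Set.sep_subset _ _)).trans_eq Real.volume_Ioo
  exact ENNReal.toReal_le_of_le_ofReal (sub_pos.2 hab).le h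

theorem lintegral_distFun_mul_deriv_le_one {Φ Φ' : ℝ → ℝ} (hΦ0 : Φ 0 = 0)
    (hΦdiff : ∀ t ∈ Set.Ici (0:ℝ), HasDerivWithinAt Φ (Φ' t) (Set.Ici (0:ℝ)) t)
    (hΦ'mono : MonotoneOn Φ' (Set.Ici 0)) (hΦ'nonneg : ∀ t, 0 ≤ t → 0 ≤ Φ' t)
    {a b : ℝ} (hab : a < b) {u : ℝ → ℝ} (hu : Measurable u) (hu0 : ∀ x, 0 ≤ u x)
    (h : ∫⁻ x in Set.Ioo a b, ENNReal.ofReal (Φ (u x)) ≤ ENNReal.ofReal (b - a)) :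
    ∫⁻ t in Set.Ioi (0:ℝ), ENNReal.ofReal (distFun a b u t * Φ' t) ≤ 1 := by
  have hba : 0 < b - a := sub_pos.2 hab
  have hint : ∀ t, 0 ≤ t → IntervalIntegrable Φ' volume 0 t := fun t ht => by
    apply MonotoneOn.intervalIntegrable
    rw [Set.uIcc_of_le ht]
    exact hΦ'mono.mono Set.Icc_subset_Ici_self
  have hftc : ∀ t, 0 ≤ t → ∫ s in (0:ℝ)..t, Φ' s = Φ t := by
    intro t ht
    rw [intervalIntegral.integral_eq_sub_of_hasDeriv_right_of_le (f := Φ) ht ?_ ?_ (hint t ht), hΦ0, sub_zero]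
    · exact fun s hs => ((hΦdiff s hs.1).continuousWithinAt).mono Set.Icc_subset_Ici_self
    · exact fun s hs => (hΦdiff s hs.1.le).mono fun _ hr => hs.1.le.trans (le_of_lt hr)
  have hcake := lintegral_comp_eq_lintegral_meas_lt_mul (volume.restrict (Set.Ioo a b))
    (f := u) (g := Φ') (Filter.Eventually.of_forall hu0) hu.aemeasurable
    (fun t ht => hint t (le_of_lt ht))
    ((ae_restrict_iff' measurableSet_Ioi).2
      (Filter.Eventually.of_forall fun t ht => hΦ'nonneg t (le_of_lt ht)))
  simp only [hftc _ (hu0 _)] at hcake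
  have hpt : ∀ t, ENNReal.ofReal (distFun a b u t * Φ' t) =
      (ENNReal.ofReal (b - a))⁻¹ *
        (volume.restrict (Set.Ioo a b) {x | t < u x} * ENNReal.ofReal (Φ' t)) := by
    intro t
    have hset : MeasurableSet {x | t < u x} := measurableSet_lt measurable_const hu
    have hfin : volume {x ∈ Set.Ioo a b | t < u x} ≠ ⊤ :=
      ((measure_mono (Set.sep_subset _ _)).trans_lt measure_Ioo_lt_top).ne
    have hinter : {x | t < u x} ∩ Set.Ioo a b = {x ∈ Set.Ioo a b | t < u x} := by
      ext x
      exact and_comm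
    rw [ENNReal.ofReal_mul (distFun_nonneg hab u t), Measure.restrict_apply hset, hinter, distFun,
      ENNReal.ofReal_div_of_pos hba, ENNReal.ofReal_toReal hfin, ENNReal.div_eq_inv_mul, mul_assoc]
  simp only [hpt]
  rw [lintegral_const_mul' _ _ (ENNReal.inv_ne_top.2 (by simpa using hab)), ← hcake]
  exact (mul_le_mul_right h _).trans (ENNReal.inv_mul_le_one _)

/-- Lemma 1.1: the lower bound `n_Ψ(N_I^w) ≤ C·‖w‖_{L^Φ(I)}` for the
Orlicz norm.  The conclusion `n_Ψ(N_I^w) ≤ C·λ` is stated for every `λ > 0` which is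
admissible for the normalized Orlicz norm, i.e. `|I|⁻¹∫_I Φ(w/λ) ≤ 1`; this is
equivalent to the inequality with `‖w‖_{L^Φ(I)} = inf` of such `λ`. -/
theorem statement0 (Ψ : ℝ → ℝ)
    (hΨpos : ∀ s ∈ Set.Ioc (0:ℝ) 1, 0 < Ψ s)
    (hΨdec : AntitoneOn Ψ (Set.Ioc (0:ℝ) 1))
    (hφinc : MonotoneOn (fun s => s * Ψ s) (Set.Ioc (0:ℝ) 1))
    (Φ Φ' : ℝ → ℝ)
    (hΦcont : ContinuousOn Φ (Set.Ici (0:ℝ)))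
    (hΦmono : MonotoneOn Φ (Set.Ici (0:ℝ)))
    (hΦconv : ConvexOn ℝ (Set.Ici (0:ℝ)) Φ)
    (hΦ0 : Φ 0 = 0)
    (hΦdiff : ∀ t ∈ Set.Ici (0:ℝ), HasDerivWithinAt Φ (Φ' t) (Set.Ici (0:ℝ)) t)
    (C₀ t₀ : ℝ) (hC₀ : 0 < C₀) (ht₀ : 0 < t₀)
    (hdom : ∀ t, t₀ ≤ t → (Φ t * Φ' t)⁻¹ ∈ Set.Ioc (0:ℝ) 1)
    (hΨΦ : ∀ t, t₀ ≤ t → Ψ ((Φ t * Φ' t)⁻¹) ≤ C₀ * Φ' t) :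
    ∃ C : ℝ, 0 < C ∧
      ∀ a b : ℝ, a < b → ∀ w : ℝ → ℝ, Measurable w → (∀ x, 0 ≤ w x) →
        ∀ lam : ℝ, 0 < lam →
          (∫⁻ x in Set.Ioo a b, ENNReal.ofReal (Φ (w x / lam))) ≤
            ENNReal.ofReal (b - a) →
          nPsiE Ψ (distFun a b w) ≤ ENNReal.ofReal (C * lam) := by
  have hslope : ∀ x y, 0 ≤ x → x < y → Φ' x * (y - x) ≤ Φ y - Φ x := by
    intro x y hx hxy
    have h := hΦconv.le_slope_of_hasDerivWithinAt hx (hx.trans hxy.le : (0:ℝ) ≤ y) hxy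
      (hΦdiff x hx)
    rwa [slope_def_field, le_div_iff₀ (sub_pos.2 hxy)] at h
  have hderiv : ∀ t ∈ Set.Ici (0:ℝ), derivWithin Φ (Set.Ici 0) t = Φ' t := fun t ht =>
    (hΦdiff t ht).derivWithin (uniqueDiffOn_Ici 0 t ht)
  have hΦ'mono : MonotoneOn Φ' (Set.Ici 0) :=
    (hΦconv.monotoneOn_derivWithin fun t ht => (hΦdiff t ht).differentiableWithinAt).congr hderiv
  have hΦ'nonneg : ∀ t, 0 ≤ t → 0 ≤ Φ' t := fun t ht => by
    rw [← hderiv t ht]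
    exact hΦmono.derivWithin_nonneg
  have hΦnonneg : ∀ t, 0 ≤ t → 0 ≤ Φ t := fun t ht =>
    hΦ0.symm.le.trans (hΦmono Set.self_mem_Ici ht ht)
  have hm : 0 < Φ' t₀ :=
    pos_of_mul_pos_right (inv_pos.1 (hdom t₀ le_rfl).1) (hΦnonneg t₀ ht₀.le)
  have hΨ1 := hΨpos 1 ⟨one_pos, le_rfl⟩
  have hCpos : 0 < Ψ 1 * t₀ + 2 * C₀ / Φ' t₀ + 2 * C₀ := by positivity
  refine ⟨_, hCpos, fun a b hab w hw hw0 lam hlam h => ?_⟩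
  have hN := lintegral_distFun_mul_deriv_le_one hΦ0 hΦdiff hΦ'mono hΦ'nonneg hab
    (hw.div_const lam) (fun x => div_nonneg (hw0 x) hlam.le) h
  rw [nPsiE_distFun_eq_mul Ψ w a b hlam, mul_comm _ lam, ENNReal.ofReal_mul hlam.le]
  refine mul_le_mul_right ?_ _
  exact lintegral_psiWeight_le hΨpos hΨdec hφinc hC₀ ht₀ hm
    (hΦ'mono.mono (Set.Ici_subset_Ici.2 ht₀.le)) (fun t ht => hΦnonneg t (ht₀.le.trans ht))
    (fun x y hx => hslope x y (ht₀.le.trans hx)) hdom hΨΦ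
    (distFun_nonneg hab _) (distFun_le_one hab _) hN
end

section
/- Let Φ : [0,∞) → [0,∞) be twice continuously differentiable, increasing, and convex with Φ(0) = 0, let t₀ > 0 be such that Φ'(t) > 0 for t ≥ t₀, and assume ∫_{t₀}^∞ dt/Φ(t) < ∞. Define σ(t) := 1/(Φ(t)Φ'(t)) for t ≥ t₀; then σ is strictly decreasing with lim_{t→∞} σ(t) = 0, and the function Ψ(s) := Φ'(σ^{-1}(s)) defined for s ∈ (0, σ(t₀)] satisfies: Ψ is positive and decreasing, s ↦ sΨ(s) is increasing, and ∫₀^{σ(t₀)} ds/(sΨ(s)) < ∞; moreover ∫_{t₀}^∞ (1/Φ(t) + Φ''(t)/Φ'(t)²) dt < ∞ and this integral equals ∫₀^{σ(t₀)} ds/(sΨ(s)). -/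
open MeasureTheory Filter

/-- construction of the bump functional `Ψ` from a Young function `Φ`.
If `Φ` is C², increasing, convex, `Φ(0) = 0`, `Φ' > 0` on `[t₀,∞)` and
`∫_{t₀}^∞ dt/Φ(t) < ∞`, then `σ(t) := 1/(Φ(t)Φ'(t))` is strictly decreasing on
`[t₀,∞)` with `σ(t) → 0`, and the function `Ψ(s) := Φ'(σ⁻¹(s))` on `(0, σ(t₀)]`
(expressed here as a function `Ψ` with `Ψ(σ(t)) = Φ'(t)` for `t ≥ t₀`) is positive and
decreasing, `s ↦ sΨ(s)` is increasing, `∫₀^{σ(t₀)} ds/(sΨ(s)) < ∞`; moreover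
`∫_{t₀}^∞ (1/Φ + Φ''/Φ'²) < ∞` and this integral equals `∫₀^{σ(t₀)} ds/(sΨ(s))`. -/
theorem statement1 (Φ Φ' Φ'' : ℝ → ℝ) (t₀ : ℝ) (ht₀ : 0 < t₀)
    (hΦd1 : ∀ t ∈ Set.Ici (0:ℝ), HasDerivWithinAt Φ (Φ' t) (Set.Ici (0:ℝ)) t)
    (hΦd2 : ∀ t ∈ Set.Ici (0:ℝ), HasDerivWithinAt Φ' (Φ'' t) (Set.Ici (0:ℝ)) t)
    (hΦ''c : ContinuousOn Φ'' (Set.Ici (0:ℝ)))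
    (hΦmono : MonotoneOn Φ (Set.Ici (0:ℝ)))
    (hΦconv : ConvexOn ℝ (Set.Ici (0:ℝ)) Φ)
    (hΦ0 : Φ 0 = 0)
    (hΦ'pos : ∀ t, t₀ ≤ t → 0 < Φ' t)
    (hint : IntegrableOn (fun t => (Φ t)⁻¹) (Set.Ici t₀)) :
    StrictAntiOn (fun t => (Φ t * Φ' t)⁻¹) (Set.Ici t₀) ∧
    Tendsto (fun t => (Φ t * Φ' t)⁻¹) atTop (nhds 0) ∧
    ∃ Ψ : ℝ → ℝ,
      (∀ t, t₀ ≤ t → Ψ ((Φ t * Φ' t)⁻¹) = Φ' t) ∧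
      (∀ s ∈ Set.Ioc (0:ℝ) ((Φ t₀ * Φ' t₀)⁻¹), 0 < Ψ s) ∧
      AntitoneOn Ψ (Set.Ioc (0:ℝ) ((Φ t₀ * Φ' t₀)⁻¹)) ∧
      MonotoneOn (fun s => s * Ψ s) (Set.Ioc (0:ℝ) ((Φ t₀ * Φ' t₀)⁻¹)) ∧
      IntegrableOn (fun s => (s * Ψ s)⁻¹) (Set.Ioc (0:ℝ) ((Φ t₀ * Φ' t₀)⁻¹)) ∧
      IntegrableOn (fun t => (Φ t)⁻¹ + Φ'' t / (Φ' t) ^ 2) (Set.Ici t₀) ∧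
      (∫ t in Set.Ici t₀, ((Φ t)⁻¹ + Φ'' t / (Φ' t) ^ 2)) =
        ∫ s in Set.Ioc (0:ℝ) ((Φ t₀ * Φ' t₀)⁻¹), (s * Ψ s)⁻¹ := by
  have h0 : ∀ t, t₀ ≤ t → (0:ℝ) ≤ t := fun t ht => ht₀.le.trans ht
  have hsub : Set.Ici t₀ ⊆ Set.Ici (0:ℝ) := Set.Ici_subset_Ici.mpr ht₀.le
  have hd1 : ∀ t, t₀ ≤ t → HasDerivAt Φ (Φ' t) t := fun t ht =>
    (hΦd1 t (h0 t ht)).hasDerivAt (Ici_mem_nhds (ht₀.trans_le ht))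
  have hd2 : ∀ t, t₀ ≤ t → HasDerivAt Φ' (Φ'' t) t := fun t ht =>
    (hΦd2 t (h0 t ht)).hasDerivAt (Ici_mem_nhds (ht₀.trans_le ht))
  have hΦ'mono : MonotoneOn Φ' (Set.Ici (0:ℝ)) := by
    refine (hΦconv.monotoneOn_derivWithin
      (fun t ht => (hΦd1 t ht).differentiableWithinAt)).congr (fun t ht => ?_)
    exact (hΦd1 t ht).derivWithin (uniqueDiffOn_Ici 0 t ht)
  have hΦ''nonneg : ∀ t, t₀ ≤ t → 0 ≤ Φ'' t := by
    intro t ht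
    rw [← (hΦd2 t (h0 t ht)).derivWithin (uniqueDiffOn_Ici 0 t (h0 t ht))]
    exact hΦ'mono.derivWithin_nonneg
  have hΦt₀ : 0 < Φ t₀ := by
    have hnn : ∀ t, 0 ≤ t → 0 ≤ Φ t := fun t ht =>
      hΦ0 ▸ hΦmono (Set.mem_Ici.mpr le_rfl) ht ht
    refine lt_of_le_of_ne (hnn t₀ ht₀.le) (fun h => ?_)
    have hmin : IsLocalMin Φ t₀ := by
      filter_upwards [Ici_mem_nhds ht₀] with t ht
      exact h ▸ hnn t ht
    exact (hΦ'pos t₀ le_rfl).ne' (hmin.hasDerivAt_eq_zero (hd1 t₀ le_rfl))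
  have hΦpos : ∀ t, t₀ ≤ t → 0 < Φ t := fun t ht =>
    hΦt₀.trans_le (hΦmono ht₀.le (h0 t ht) ht)
  have htangent : ∀ t, t₀ < t → Φ' t₀ * (t - t₀) ≤ Φ t - Φ t₀ := by
    intro t ht
    have h := hΦconv.le_slope_of_hasDerivAt ht₀.le (h0 t ht.le) ht (hd1 t₀ le_rfl)
    rwa [slope_def_field, le_div_iff₀ (sub_pos.mpr ht)] at h
  have hΦstrict : StrictMonoOn Φ (Set.Ici t₀) := by
    refine strictMonoOn_of_deriv_pos (convex_Ici t₀)
      (fun t ht => (hd1 t ht).continuousAt.continuousWithinAt) (fun t ht => ?_)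
    have ht' : t₀ ≤ t := interior_subset ht
    rw [(hd1 t ht').deriv]
    exact hΦ'pos t ht'
  have hanti : StrictAntiOn (fun t => (Φ t * Φ' t)⁻¹) (Set.Ici t₀) := by
    intro a ha b hb hab
    exact inv_strictAnti₀ (mul_pos (hΦpos a ha) (hΦ'pos a ha))
      (mul_lt_mul (hΦstrict ha hb hab) (hΦ'mono (hsub ha) (hsub hb) hab.le)
        (hΦ'pos a ha) (hΦpos b hb).le)
  have htend : Tendsto (fun t => (Φ t * Φ' t)⁻¹) atTop (nhds 0) := by
    refine tendsto_inv_atTop_zero.comp ?_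
    have hlin : Tendsto (fun t => (Φ' t₀ * (t - t₀)) * Φ' t₀) atTop atTop :=
      ((tendsto_atTop_add_const_right atTop (-t₀) tendsto_id).const_mul_atTop
        (hΦ'pos t₀ le_rfl)).atTop_mul_const (hΦ'pos t₀ le_rfl)
    refine tendsto_atTop_mono' atTop ?_ hlin
    filter_upwards [eventually_gt_atTop t₀] with t ht
    exact mul_le_mul (by linarith [htangent t ht]) (hΦ'mono ht₀.le (h0 t ht.le) ht.le)
      (hΦ'pos t₀ le_rfl).le (hΦpos t ht.le).le
  refine ⟨hanti, htend, ?_⟩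
  set σ : ℝ → ℝ := fun t => (Φ t * Φ' t)⁻¹ with hσ
  have hσpos : ∀ t, t₀ ≤ t → 0 < σ t := fun t ht =>
    inv_pos.mpr (mul_pos (hΦpos t ht) (hΦ'pos t ht))
  have hσd : ∀ t, t₀ ≤ t →
      HasDerivAt σ (-(Φ' t * Φ' t + Φ t * Φ'' t) / (Φ t * Φ' t) ^ 2) t := fun t ht =>
    ((hd1 t ht).mul (hd2 t ht)).fun_inv (mul_pos (hΦpos t ht) (hΦ'pos t ht)).ne'
  have himage : σ '' Set.Ici t₀ = Set.Ioc 0 (σ t₀) := by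
    apply Set.Subset.antisymm
    · rintro _ ⟨t, ht, rfl⟩
      exact ⟨hσpos t ht, hanti.antitoneOn Set.self_mem_Ici ht ht⟩
    · rintro s ⟨hs0, hs⟩
      obtain ⟨T, hTs, hT⟩ := ((htend.eventually_lt_const hs0).and
        (eventually_ge_atTop t₀)).exists
      have hivt := intermediate_value_Icc' hT
        (fun t ht => (hσd t ht.1).continuousAt.continuousWithinAt)
      obtain ⟨t, ht, rfl⟩ := hivt ⟨hTs.le, hs⟩
      exact ⟨t, ht.1, rfl⟩
  set Ψ : ℝ → ℝ := fun s => Φ' (Function.invFunOn σ (Set.Ici t₀) s)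
  have hΨ : ∀ t, t₀ ≤ t → Ψ (σ t) = Φ' t := fun t ht =>
    congrArg Φ' (hanti.injOn.leftInvOn_invFunOn ht)
  have hprod : ∀ t, t₀ ≤ t → σ t * Ψ (σ t) = (Φ t)⁻¹ := by
    intro t ht
    have h1 := (hΦpos t ht).ne'
    have h2 := (hΦ'pos t ht).ne'
    rw [hΨ t ht, hσ]
    field_simp
  have hcov : Set.EqOn
      (fun t => |-(Φ' t * Φ' t + Φ t * Φ'' t) / (Φ t * Φ' t) ^ 2| • (σ t * Ψ (σ t))⁻¹)
      (fun t => (Φ t)⁻¹ + Φ'' t / (Φ' t) ^ 2) (Set.Ici t₀) := by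
    intro t ht
    have h1 := hΦpos t ht
    have h2 := hΦ'pos t ht
    have h3 := hΦ''nonneg t ht
    have h4 : 0 ≤ (Φ' t * Φ' t + Φ t * Φ'' t) / (Φ t * Φ' t) ^ 2 := by positivity
    simp only [hprod t ht, inv_inv, smul_eq_mul]
    rw [neg_div, abs_neg, abs_of_nonneg h4]
    field_simp
  have hint₂ : IntegrableOn (fun t => Φ'' t / (Φ' t) ^ 2) (Set.Ici t₀) := by
    rw [integrableOn_Ici_iff_integrableOn_Ioi]
    have hd : ∀ t, t₀ ≤ t → HasDerivAt (fun t => -(Φ' t)⁻¹) (Φ'' t / (Φ' t) ^ 2) t := by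
      intro t ht
      simpa only [neg_div, neg_neg] using ((hd2 t ht).fun_inv (hΦ'pos t ht).ne').fun_neg
    have hmono : Monotone (fun t => -(Φ' (max t t₀))⁻¹) := by
      intro a b hab
      exact neg_le_neg (inv_anti₀ (hΦ'pos _ (le_max_right _ _))
        (hΦ'mono (h0 _ (le_max_right _ _)) (h0 _ (le_max_right _ _))
          (max_le_max_right t₀ hab)))
    have hbdd : BddAbove (Set.range (fun t => -(Φ' (max t t₀))⁻¹)) := by
      refine ⟨0, ?_⟩
      rintro _ ⟨t, rfl⟩
      exact neg_nonpos.mpr (inv_pos.mpr (hΦ'pos _ (le_max_right _ _))).le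
    refine integrableOn_Ioi_deriv_of_nonneg
      (hd t₀ le_rfl).continuousAt.continuousWithinAt (fun t ht => hd t (le_of_lt ht))
      (fun t ht => div_nonneg (hΦ''nonneg t (le_of_lt ht)) (sq_nonneg _))
      ((tendsto_atTop_ciSup hmono hbdd).congr' ?_)
    filter_upwards [eventually_ge_atTop t₀] with t ht
    rw [max_eq_left ht]
  have hint₃ : IntegrableOn (fun t => (Φ t)⁻¹ + Φ'' t / (Φ' t) ^ 2) (Set.Ici t₀) :=
    hint.add hint₂
  change ∃ Ψ : ℝ → ℝ, (∀ t, t₀ ≤ t → Ψ (σ t) = Φ' t) ∧ (∀ s ∈ Set.Ioc 0 (σ t₀), 0 < Ψ s) ∧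
      AntitoneOn Ψ (Set.Ioc 0 (σ t₀)) ∧ MonotoneOn (fun s => s * Ψ s) (Set.Ioc 0 (σ t₀)) ∧
      IntegrableOn (fun s => (s * Ψ s)⁻¹) (Set.Ioc 0 (σ t₀)) ∧
      IntegrableOn (fun t => (Φ t)⁻¹ + Φ'' t / (Φ' t) ^ 2) (Set.Ici t₀) ∧
      (∫ t in Set.Ici t₀, ((Φ t)⁻¹ + Φ'' t / (Φ' t) ^ 2)) =
        ∫ s in Set.Ioc 0 (σ t₀), (s * Ψ s)⁻¹
  rw [← himage]
  refine ⟨Ψ, hΨ, ?_, ?_, ?_, ?_, hint₃, ?_⟩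
  · rintro _ ⟨t, ht, rfl⟩
    rw [hΨ t ht]
    exact hΦ'pos t ht
  · rintro _ ⟨a, ha, rfl⟩ _ ⟨b, hb, rfl⟩ hab
    rw [hΨ a ha, hΨ b hb]
    exact hΦ'mono (hsub hb) (hsub ha) ((hanti.le_iff_ge ha hb).mp hab)
  · rintro _ ⟨a, ha, rfl⟩ _ ⟨b, hb, rfl⟩ hab
    simp only [hprod a ha, hprod b hb]
    exact inv_anti₀ (hΦpos b hb)
      (hΦmono (hsub hb) (hsub ha) ((hanti.le_iff_ge ha hb).mp hab))
  · rw [integrableOn_image_iff_integrableOn_abs_deriv_smul measurableSet_Ici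
      (fun t ht => (hσd t ht).hasDerivWithinAt) hanti.injOn]
    exact hint₃.congr_fun hcov.symm measurableSet_Ici
  · rw [integral_image_eq_integral_abs_deriv_smul measurableSet_Ici
      (fun t ht => (hσd t ht).hasDerivWithinAt) hanti.injOn]
    exact setIntegral_congr_fun measurableSet_Ici hcov.symm
end

section
/- Let t₀ > 1 and let ρ : [t₀,∞) → [1,∞) be continuously differentiable and increasing with lim_{t→∞} ρ(t) = ∞, such that t ↦ tρ'(t)/ρ(t) is decreasing on [t₀,∞) and lim_{t→∞} (tρ'(t)/ρ(t))·log ρ(t) = 0. Let Φ be a differentiable Young function with Φ(t) = tρ(t) for t ≥ t₀, define σ(t) := 1/(Φ(t)Φ'(t)) (strictly decreasing to 0 on [t₀,∞)) and Ψ(s) := Φ'(σ^{-1}(s)) for s ∈ (0, σ(t₀)], extended to (0,1] as a positive decreasing function with sΨ(s) increasing. Then there exists a constant C = C(Φ) such that for every interval I ⊂ ℝ of finite positive length and every nonnegative measurable w on ℝ, ‖w‖_{L^Φ(I)} ≤ C·∫₀^∞ N_I^w(t)·Ψ(N_I^w(t)) dt (the integrand taken to be 0 where N_I^w(t) = 0).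 -/
open MeasureTheory Filter

/-- A convex function lies above its tangents. -/
lemma ConvexOn.tangent_le_of_hasDerivWithinAt {S : Set ℝ} {f : ℝ → ℝ} {f' x y : ℝ}
    (hf : ConvexOn ℝ S f) (hx : x ∈ S) (hy : y ∈ S) (hf' : HasDerivWithinAt f f' S x) :
    f x + f' * (y - x) ≤ f y := by
  rcases lt_trichotomy x y with h | rfl | h
  · have := hf.le_slope_of_hasDerivWithinAt hx hy h hf'
    rw [slope_def_field, le_div_iff₀ (sub_pos.2 h)] at this
    linarith
  · simp
  · have := hf.slope_le_of_hasDerivWithinAt hy hx h hf'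
    rw [slope_def_field, div_le_iff₀ (sub_pos.2 h)] at this
    linarith

/-- A convex function on `[0, ∞)` vanishing at `0` is dominated by its chords from the origin. -/
lemma ConvexOn.map_mul_le_mul {f : ℝ → ℝ} (hf : ConvexOn ℝ (Set.Ici (0 : ℝ)) f) (h0 : f 0 = 0)
    {c x : ℝ} (hx : 0 ≤ x) (hc : 0 ≤ c) (hc1 : c ≤ 1) : f (c * x) ≤ c * f x := by
  have := hf.2 (Set.mem_Ici.2 hx) (Set.mem_Ici.2 le_rfl) hc (sub_nonneg.2 hc1) (by ring)
  simpa [h0] using this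

/-- If the logarithmic derivative `t ρ'(t) / ρ(t)` decreases, then `ρ` grows from `t` to `t s`
at most like the power `t ρ'(t) / ρ(t)` of `s`. -/
lemma log_sub_log_le_of_antitoneOn_logDeriv {t₀ : ℝ} (ht₀ : 0 < t₀) {ρ ρ' : ℝ → ℝ}
    (hρd : ∀ t ∈ Set.Ici t₀, HasDerivWithinAt ρ (ρ' t) (Set.Ici t₀) t)
    (hρ1 : ∀ t, t₀ ≤ t → 0 < ρ t)
    (hconc : AntitoneOn (fun t => t * ρ' t / ρ t) (Set.Ici t₀))
    {t s : ℝ} (ht : t₀ ≤ t) (hs : 1 ≤ s) :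
    Real.log (ρ (t * s)) - Real.log (ρ t) ≤ t * ρ' t / ρ t * Real.log s := by
  have htpos : 0 < t := ht₀.trans_le ht
  set e := t * ρ' t / ρ t with he
  have hd : ∀ x ∈ Set.Ici t, HasDerivWithinAt (fun x => Real.log (ρ x) - e * Real.log x)
      (ρ' x / ρ x - e * x⁻¹) (Set.Ici t) x := by
    intro x hx
    have hx0 : 0 < x := htpos.trans_le hx
    have hxt : t₀ ≤ x := ht.trans hx
    refine HasDerivWithinAt.sub ?_ ?_
    · exact ((hρd x hxt).mono (Set.Ici_subset_Ici.2 ht)).log (hρ1 x hxt).ne'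
    · exact ((Real.hasDerivAt_log hx0.ne').const_mul e).hasDerivWithinAt
  have hanti : AntitoneOn (fun x => Real.log (ρ x) - e * Real.log x) (Set.Ici t) := by
    refine antitoneOn_of_hasDerivWithinAt_nonpos (f' := fun x => ρ' x / ρ x - e * x⁻¹)
      (convex_Ici t) (fun x hx => (hd x hx).continuousWithinAt)
      (fun x hx => (hd x (interior_subset hx)).mono interior_subset) ?_
    intro x hx
    have hx : t ≤ x := interior_subset hx
    have hx0 : 0 < x := htpos.trans_le hx
    have h1 : x * ρ' x / ρ x ≤ e := hconc (Set.mem_Ici.2 ht) (Set.mem_Ici.2 (ht.trans hx)) hx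
    have h2 : ρ' x / ρ x = x * ρ' x / ρ x * x⁻¹ := by
      field_simp
    rw [h2, ← sub_mul]
    exact mul_nonpos_of_nonpos_of_nonneg (sub_nonpos.2 h1) (inv_nonneg.2 hx0.le)
  have h := hanti (Set.mem_Ici.2 le_rfl) (Set.mem_Ici.2 (le_mul_of_one_le_right htpos.le hs))
    (le_mul_of_one_le_right htpos.le hs)
  simp only at h
  rw [Real.log_mul htpos.ne' (by positivity)] at h
  linarith

/-- Under the logarithmic regularity condition, `ρ(t ρ(t))` is comparable to `ρ(t)`. -/
lemma exists_comp_mul_self_le {t₀ : ℝ} (ht₀ : 0 < t₀) {ρ ρ' : ℝ → ℝ}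
    (hρd : ∀ t ∈ Set.Ici t₀, HasDerivWithinAt ρ (ρ' t) (Set.Ici t₀) t)
    (hρ1 : ∀ t, t₀ ≤ t → 1 ≤ ρ t)
    (hρmono : MonotoneOn ρ (Set.Ici t₀))
    (hconc : AntitoneOn (fun t => t * ρ' t / ρ t) (Set.Ici t₀))
    (hloglim : Tendsto (fun t => t * ρ' t / ρ t * Real.log (ρ t)) atTop (nhds 0)) :
    ∃ C : ℝ, 0 < C ∧ ∀ t, t₀ ≤ t → ρ (t * ρ t) ≤ C * ρ t := by
  have hself : ∀ t, t₀ ≤ t → t₀ ≤ t * ρ t := fun t ht =>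
    ht.trans (le_mul_of_one_le_right (ht₀.le.trans ht) (hρ1 t ht))
  obtain ⟨T, hT0, hT⟩ := ((eventually_ge_atTop t₀).and
    (eventually_forall_ge_atTop.2 (hloglim.eventually (gt_mem_nhds one_pos)))).exists
  refine ⟨max (Real.exp 1) (ρ (T * ρ T)), lt_max_of_lt_left (Real.exp_pos 1), fun t ht => ?_⟩
  have hpos : 0 < ρ t := one_pos.trans_le (hρ1 t ht)
  rcases le_total T t with h | h
  · have h1 := log_sub_log_le_of_antitoneOn_logDeriv ht₀ hρd
      (fun t ht => one_pos.trans_le (hρ1 t ht)) hconc ht (hρ1 t ht)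
    have h2 := hT t h
    have h3 : Real.log (ρ (t * ρ t)) ≤ 1 + Real.log (ρ t) := by linarith
    rw [Real.log_le_iff_le_exp (one_pos.trans_le (hρ1 _ (hself t ht))), Real.exp_add,
      Real.exp_log hpos] at h3
    exact h3.trans (mul_le_mul_of_nonneg_right (le_max_left _ _) hpos.le)
  · have h1 : ρ t ≤ ρ T := hρmono ht hT0 h
    have h2 : t * ρ t ≤ T * ρ T := mul_le_mul h h1 hpos.le (ht₀.le.trans hT0)
    calc ρ (t * ρ t) ≤ ρ (T * ρ T) := hρmono (hself t ht) (hself T hT0) h2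
      _ ≤ ρ (T * ρ T) * ρ t :=
        le_mul_of_one_le_right (one_pos.trans_le (hρ1 _ (hself T hT0))).le (hρ1 t ht)
      _ ≤ _ := mul_le_mul_of_nonneg_right (le_max_right _ _) hpos.le

/-- The distribution function takes values in `[0, 1]`. -/
lemma distFun_mem_Icc {a b : ℝ} (hab : a < b) (w : ℝ → ℝ) (t : ℝ) :
    distFun a b w t ∈ Set.Icc (0 : ℝ) 1 := by
  have hba : 0 < b - a := sub_pos.2 hab
  refine ⟨div_nonneg ENNReal.toReal_nonneg hba.le, ?_⟩
  rw [distFun, div_le_one hba]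
  refine ENNReal.toReal_le_of_le_ofReal hba.le ?_
  rw [← Real.volume_Ioo]
  exact measure_mono fun x hx => hx.1

/-- The measure of a superlevel set in terms of the distribution function. -/
lemma volume_superlevel_eq_distFun {a b : ℝ} (hab : a < b) (w : ℝ → ℝ) (t : ℝ) :
    volume {x ∈ Set.Ioo a b | t < w x} = ENNReal.ofReal (distFun a b w t * (b - a)) := by
  have hfin : volume {x ∈ Set.Ioo a b | t < w x} ≠ ⊤ :=
    ne_top_of_le_ne_top measure_Ioo_lt_top.ne (measure_mono fun x hx => hx.1)
  rw [distFun, div_mul_cancel₀ _ (sub_pos.2 hab).ne', ENNReal.ofReal_toReal hfin]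

/-- The distribution function is decreasing. -/
lemma distFun_antitone {a b : ℝ} (hab : a < b) (w : ℝ → ℝ) : Antitone (distFun a b w) := by
  intro s t hst
  refine div_le_div_of_nonneg_right (ENNReal.toReal_mono ?_ ?_) (sub_pos.2 hab).le
  · exact ne_top_of_le_ne_top measure_Ioo_lt_top.ne (measure_mono fun x hx => hx.1)
  · exact measure_mono fun x hx => ⟨hx.1, hst.trans_lt hx.2⟩

/-- The integrand of `nPsiE` is measurable when `s ↦ s Ψ(s)` is increasing. -/
lemma measurable_distFun_mul_comp {a b : ℝ} (hab : a < b) (w : ℝ → ℝ) {Ψ : ℝ → ℝ}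
    (hΨpos : ∀ s ∈ Set.Ioc (0:ℝ) 1, 0 < Ψ s)
    (hφinc : MonotoneOn (fun s => s * Ψ s) (Set.Ioc (0:ℝ) 1)) :
    Measurable fun t => if distFun a b w t = 0 then 0
      else distFun a b w t * Ψ (distFun a b w t) := by
  refine Antitone.measurable fun s t hst => ?_
  have hs := distFun_mem_Icc hab w s
  have ht := distFun_mem_Icc hab w t
  have hle := distFun_antitone hab w hst
  by_cases h : distFun a b w t = 0
  · simp only [h, if_true]
    split_ifs with h'
    · exact le_rfl
    · have h'' : 0 < distFun a b w s := lt_of_le_of_ne hs.1 (Ne.symm h')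
      exact (mul_pos h'' (hΨpos _ ⟨h'', hs.2⟩)).le
  · have h' : 0 < distFun a b w t := lt_of_le_of_ne ht.1 (Ne.symm h)
    rw [if_neg h, if_neg (h'.trans_le hle).ne']
    exact hφinc ⟨h', ht.2⟩ ⟨h'.trans_le hle, hs.2⟩ hle

/-- If the indicator of a set of density `s` has Orlicz norm at most `C s Ψ(s)`, then the Orlicz
norm of `w` is at most `C` times the Lorentz-type functional `nPsiE`. -/
lemma lintegral_young_le_of_indicator_bound {Φ Φ' Ψ : ℝ → ℝ}
    (hΦmono : MonotoneOn Φ (Set.Ici (0:ℝ)))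
    (hΦconv : ConvexOn ℝ (Set.Ici (0:ℝ)) Φ)
    (hΦ0 : Φ 0 = 0)
    (hΦdiff : ∀ t ∈ Set.Ici (0:ℝ), HasDerivWithinAt Φ (Φ' t) (Set.Ici (0:ℝ)) t)
    (hΨpos : ∀ s ∈ Set.Ioc (0:ℝ) 1, 0 < Ψ s)
    (hφinc : MonotoneOn (fun s => s * Ψ s) (Set.Ioc (0:ℝ) 1))
    {C : ℝ} (hC : 0 < C)
    (hbound : ∀ s ∈ Set.Ioc (0:ℝ) 1, Φ (C * (s * Ψ s))⁻¹ ≤ s⁻¹)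
    {a b : ℝ} (hab : a < b) {w : ℝ → ℝ} (hw : Measurable w) (hw0 : ∀ x, 0 ≤ w x)
    (hfin : nPsiE Ψ (distFun a b w) ≠ ⊤) {lam : ℝ}
    (hlam : C * (nPsiE Ψ (distFun a b w)).toReal < lam) :
    (∫⁻ x in Set.Ioo a b, ENNReal.ofReal (Φ (w x / lam))) ≤ ENNReal.ofReal (b - a) := by
  have hlam0 : 0 < lam := (mul_nonneg hC.le ENNReal.toReal_nonneg).trans_lt hlam
  have hba : 0 < b - a := sub_pos.2 hab
  set N := distFun a b w with hN
  set F : ℝ → ℝ := fun t => if N t = 0 then 0 else N t * Ψ (N t) with hF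
  have hNmem : ∀ t, N t ∈ Set.Icc (0 : ℝ) 1 := distFun_mem_Icc hab w
  have hFmeas : Measurable F := measurable_distFun_mul_comp hab w hΨpos hφinc
  have hNmeas : Measurable N := (distFun_antitone hab w).measurable
  have hF0 : ∀ t, 0 ≤ F t := by
    intro t
    simp only [hF]
    split_ifs with h
    · exact le_rfl
    · have h' : 0 < N t := lt_of_le_of_ne (hNmem t).1 (Ne.symm h)
      exact (mul_pos h' (hΨpos _ ⟨h', (hNmem t).2⟩)).le
  have hmass : ∫⁻ t in Set.Ioi (0:ℝ), ENNReal.ofReal (C / lam * F t) ≤ 1 := by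
    have h1 : ∀ t, ENNReal.ofReal (C / lam * F t)
        = ENNReal.ofReal (C / lam) * ENNReal.ofReal (F t) := fun t =>
      ENNReal.ofReal_mul (by positivity)
    simp_rw [h1]
    rw [lintegral_const_mul _ hFmeas.ennreal_ofReal]
    change ENNReal.ofReal (C / lam) * nPsiE Ψ N ≤ 1
    rw [← ENNReal.ofReal_toReal hfin, ← ENNReal.ofReal_mul (by positivity),
      ENNReal.ofReal_le_one, div_mul_eq_mul_div, div_le_one hlam0]
    exact hlam.le
  set h : ℝ → ENNReal := fun t =>
    if N t = 0 then ⊤ else ENNReal.ofReal (C / lam * (F t / N t)) with hh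
  have hhmeas : Measurable h :=
    Measurable.ite (hNmeas (measurableSet_singleton 0)) measurable_const
      ((hFmeas.div hNmeas).const_mul _).ennreal_ofReal
  have hpoint : ∀ x, ENNReal.ofReal (Φ (w x / lam)) ≤
      ∫⁻ t in Set.Ioi (0:ℝ), (if t < w x then h t else 0) := by
    intro x
    have hy : 0 ≤ w x / lam := div_nonneg (hw0 x) hlam0.le
    set y := w x / lam with hydef
    set p := Φ' y with hp
    have hp0 : 0 ≤ p := (hΦdiff y hy).nonneg_of_monotoneOn
      (uniqueDiffWithinAt_iff_accPt.1 (uniqueDiffOn_Ici 0 y hy)) hΦmono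
    set q := p * y - Φ y with hq
    have hfenchel : ∀ v, 0 ≤ v → p * v ≤ Φ v + q := by
      intro v hv
      have := hΦconv.tangent_le_of_hasDerivWithinAt (Set.mem_Ici.2 hy) (Set.mem_Ici.2 hv)
        (hΦdiff y hy)
      linarith
    have hq0 : 0 ≤ q := by
      have := hfenchel 0 le_rfl
      rw [hΦ0] at this
      linarith
    have hΦy : 0 ≤ Φ y := by
      rw [← hΦ0]
      exact hΦmono (Set.mem_Ici.2 le_rfl) (Set.mem_Ici.2 hy) hy
    have hkernel : ∀ t, ENNReal.ofReal (p / lam) ≤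
        h t + ENNReal.ofReal q * ENNReal.ofReal (C / lam * F t) := by
      intro t
      by_cases hNt : N t = 0
      · simp [hh, hNt]
      · have hNpos : 0 < N t := lt_of_le_of_ne (hNmem t).1 (Ne.symm hNt)
        have hΨ := hΨpos _ ⟨hNpos, (hNmem t).2⟩
        have hFt : F t = N t * Ψ (N t) := if_neg hNt
        have hFpos : 0 < F t := hFt ▸ mul_pos hNpos hΨ
        simp only [hh, if_neg hNt]
        rw [← ENNReal.ofReal_mul hq0, ← ENNReal.ofReal_add (by positivity) (by positivity)]
        refine ENNReal.ofReal_le_ofReal ?_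
        have h1 := hfenchel (C * F t)⁻¹ (by positivity)
        have h2 := hbound _ ⟨hNpos, (hNmem t).2⟩
        rw [← hFt] at h2
        have h3 : p * (C * F t)⁻¹ ≤ (N t)⁻¹ + q := h1.trans (by linarith)
        rw [← div_eq_mul_inv, div_le_iff₀ (by positivity)] at h3
        calc p / lam ≤ ((N t)⁻¹ + q) * (C * F t) / lam := by gcongr
          _ = _ := by field_simp
    have hmain : ENNReal.ofReal (Φ y) + ENNReal.ofReal q ≤
        (∫⁻ t in Set.Ioi (0:ℝ), (if t < w x then h t else 0)) + ENNReal.ofReal q := by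
      calc ENNReal.ofReal (Φ y) + ENNReal.ofReal q
          = ENNReal.ofReal (p / lam) * ENNReal.ofReal (w x) := by
            rw [← ENNReal.ofReal_add hΦy hq0, ← ENNReal.ofReal_mul (by positivity)]
            congr 1
            rw [hq, hydef]
            ring
        _ = ∫⁻ t in Set.Ioo 0 (w x), ENNReal.ofReal (p / lam) := by
            rw [setLIntegral_const, Real.volume_Ioo, sub_zero]
        _ = ∫⁻ t in Set.Ioi (0:ℝ), (if t < w x then ENNReal.ofReal (p / lam) else 0) := by
            rw [← Set.Ioi_inter_Iio, Set.inter_comm,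
              ← setLIntegral_indicator measurableSet_Iio]
            rfl
        _ ≤ ∫⁻ t in Set.Ioi (0:ℝ), ((if t < w x then h t else 0) +
              ENNReal.ofReal q * ENNReal.ofReal (C / lam * F t)) := by
            refine lintegral_mono fun t => ?_
            dsimp only
            split_ifs
            · exact hkernel t
            · exact zero_le
        _ = (∫⁻ t in Set.Ioi (0:ℝ), (if t < w x then h t else 0)) +
              ENNReal.ofReal q * ∫⁻ t in Set.Ioi (0:ℝ), ENNReal.ofReal (C / lam * F t) := by
            rw [lintegral_add_right _ ((hFmeas.const_mul _).ennreal_ofReal.const_mul _),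
              lintegral_const_mul _ (hFmeas.const_mul _).ennreal_ofReal]
        _ ≤ _ := by
            gcongr
            exact mul_le_of_le_one_right zero_le hmass
    exact (ENNReal.add_le_add_iff_right ENNReal.ofReal_ne_top).1 hmain
  calc (∫⁻ x in Set.Ioo a b, ENNReal.ofReal (Φ (w x / lam)))
      ≤ ∫⁻ x in Set.Ioo a b, ∫⁻ t in Set.Ioi (0:ℝ), (if t < w x then h t else 0) :=
        lintegral_mono hpoint
    _ = ∫⁻ t in Set.Ioi (0:ℝ), ∫⁻ x in Set.Ioo a b, (if t < w x then h t else 0) := by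
        refine lintegral_lintegral_swap (Measurable.aemeasurable ?_)
        exact Measurable.ite (measurableSet_lt measurable_snd (hw.comp measurable_fst))
          (hhmeas.comp measurable_snd) measurable_const
    _ = ∫⁻ t in Set.Ioi (0:ℝ), ENNReal.ofReal (b - a) * ENNReal.ofReal (C / lam * F t) := by
        refine lintegral_congr fun t => ?_
        have h1 : ∫⁻ x in Set.Ioo a b, (if t < w x then h t else 0)
            = h t * volume {x ∈ Set.Ioo a b | t < w x} := by
          have hms : MeasurableSet {x | t < w x} := measurableSet_lt measurable_const hw
          change ∫⁻ x in Set.Ioo a b, {x | t < w x}.indicator (fun _ => h t) x = _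
          rw [lintegral_indicator_const hms, Measure.restrict_apply hms, Set.inter_comm]
          rfl
        rw [h1, volume_superlevel_eq_distFun hab, ← hN]
        by_cases hNt : N t = 0
        · simp [hNt, hF]
        · have hNpos : 0 < N t := lt_of_le_of_ne (hNmem t).1 (Ne.symm hNt)
          have := hF0 t
          simp only [hh, if_neg hNt]
          rw [← ENNReal.ofReal_mul (by positivity), ← ENNReal.ofReal_mul hba.le]
          congr 1
          field_simp
    _ ≤ ENNReal.ofReal (b - a) := by
        rw [lintegral_const_mul _ (hFmeas.const_mul _).ennreal_ofReal]
        exact mul_le_of_le_one_right zero_le hmass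

/-- the converse estimate `‖w‖_{L^Φ(I)} ≤ C·n_Ψ(N_I^w)` for regular
`Φ(t) = tρ(t)`.  The conclusion `‖w‖_{L^Φ(I)} ≤ C·n_Ψ(N_I^w)` is expressed as: every
`λ > C·n_Ψ(N_I^w)` is admissible for the normalized Orlicz norm, i.e.
`|I|⁻¹∫_I Φ(w/λ) ≤ 1` (the case `n_Ψ(N_I^w) = ∞` being trivial). -/
theorem statement2 (t₀ : ℝ) (ht₀ : 1 < t₀) (ρ ρ' : ℝ → ℝ)
    (hρd : ∀ t ∈ Set.Ici t₀, HasDerivWithinAt ρ (ρ' t) (Set.Ici t₀) t)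
    (hρ'c : ContinuousOn ρ' (Set.Ici t₀))
    (hρ1 : ∀ t, t₀ ≤ t → 1 ≤ ρ t)
    (hρmono : MonotoneOn ρ (Set.Ici t₀))
    (hρtop : Tendsto ρ atTop atTop)
    (hconc : AntitoneOn (fun t => t * ρ' t / ρ t) (Set.Ici t₀))
    (hloglim : Tendsto (fun t => t * ρ' t / ρ t * Real.log (ρ t)) atTop (nhds 0))
    (Φ Φ' : ℝ → ℝ)
    (hΦcont : ContinuousOn Φ (Set.Ici (0:ℝ)))
    (hΦmono : MonotoneOn Φ (Set.Ici (0:ℝ)))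
    (hΦconv : ConvexOn ℝ (Set.Ici (0:ℝ)) Φ)
    (hΦ0 : Φ 0 = 0)
    (hΦdiff : ∀ t ∈ Set.Ici (0:ℝ), HasDerivWithinAt Φ (Φ' t) (Set.Ici (0:ℝ)) t)
    (hΦρ : ∀ t, t₀ ≤ t → Φ t = t * ρ t)
    (hσanti : StrictAntiOn (fun t => (Φ t * Φ' t)⁻¹) (Set.Ici t₀))
    (hσ0 : Tendsto (fun t => (Φ t * Φ' t)⁻¹) atTop (nhds 0))
    (hσrange : ∀ t, t₀ ≤ t → (Φ t * Φ' t)⁻¹ ∈ Set.Ioc (0:ℝ) 1)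
    (Ψ : ℝ → ℝ)
    (hΨagree : ∀ t, t₀ ≤ t → Ψ ((Φ t * Φ' t)⁻¹) = Φ' t)
    (hΨpos : ∀ s ∈ Set.Ioc (0:ℝ) 1, 0 < Ψ s)
    (hΨdec : AntitoneOn Ψ (Set.Ioc (0:ℝ) 1))
    (hφinc : MonotoneOn (fun s => s * Ψ s) (Set.Ioc (0:ℝ) 1)) :
    ∃ C : ℝ, 0 < C ∧
      ∀ a b : ℝ, a < b → ∀ w : ℝ → ℝ, Measurable w → (∀ x, 0 ≤ w x) →
        nPsiE Ψ (distFun a b w) ≠ ⊤ →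
        ∀ lam : ℝ, C * (nPsiE Ψ (distFun a b w)).toReal < lam →
          (∫⁻ x in Set.Ioo a b, ENNReal.ofReal (Φ (w x / lam))) ≤
            ENNReal.ofReal (b - a) := by
  have ht₀pos : 0 < t₀ := one_pos.trans ht₀
  obtain ⟨D, hD, hDρ⟩ := exists_comp_mul_self_le ht₀pos hρd hρ1 hρmono hconc hloglim
  have hΦnonneg : ∀ v, 0 ≤ v → 0 ≤ Φ v := fun v hv => by
    simpa [hΦ0] using hΦmono (Set.mem_Ici.2 le_rfl) (Set.mem_Ici.2 hv) hv
  have hρΦ' : ∀ t, t₀ ≤ t → ρ t ≤ Φ' t := by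
    intro t ht
    have htpos : 0 < t := ht₀pos.trans_le ht
    have := hΦconv.tangent_le_of_hasDerivWithinAt (Set.mem_Ici.2 htpos.le)
      (Set.mem_Ici.2 le_rfl) (hΦdiff t htpos.le)
    rw [hΦ0, hΦρ t ht] at this
    exact le_of_mul_le_mul_left (by linarith) htpos
  have hΦ'eq : Set.EqOn Φ' (fun t => 1 * ρ t + t * ρ' t) (Set.Ici t₀) := by
    intro t ht
    have htpos : 0 < t := ht₀pos.trans_le ht
    have h1 : HasDerivWithinAt Φ (Φ' t) (Set.Ici t₀) t :=
      (hΦdiff t htpos.le).mono (Set.Ici_subset_Ici.2 ht₀pos.le)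
    have h2 : HasDerivWithinAt Φ (1 * ρ t + t * ρ' t) (Set.Ici t₀) t :=
      ((hasDerivWithinAt_id t (Set.Ici t₀)).mul (hρd t ht)).congr
        (fun x hx => hΦρ x hx) (hΦρ t ht)
    exact (uniqueDiffOn_Ici t₀ t ht).eq_deriv _ h1 h2
  have hρcont : ContinuousOn ρ (Set.Ici t₀) := fun t ht => (hρd t ht).continuousWithinAt
  have hΦ'cont : ContinuousOn Φ' (Set.Ici t₀) :=
    ((continuousOn_const.mul hρcont).add (continuousOn_id.mul hρ'c)).congr hΦ'eq
  have hσcont : ContinuousOn (fun t => (Φ t * Φ' t)⁻¹) (Set.Ici t₀) :=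
    ((hΦcont.mono (Set.Ici_subset_Ici.2 ht₀pos.le)).mul hΦ'cont).inv₀
      fun t ht => (inv_pos.1 (hσrange t ht).1).ne'
  set s₀ := (Φ t₀ * Φ' t₀)⁻¹ with hs₀
  have hs₀mem : s₀ ∈ Set.Ioc (0:ℝ) 1 := hσrange t₀ le_rfl
  set c := s₀ * Ψ s₀ with hc
  have hcpos : 0 < c := mul_pos hs₀mem.1 (hΨpos _ hs₀mem)
  have hΦ1 : 0 ≤ Φ 1 := hΦnonneg 1 zero_le_one
  set E := (1 + Φ 1) / c with hE
  have hEpos : 0 < E := by positivity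
  have hCpos : 0 < 1 + D + E := by positivity
  refine ⟨1 + D + E, hCpos, fun a b hab w hw hw0 hfin lam hlam =>
    lintegral_young_le_of_indicator_bound hΦmono hΦconv hΦ0 hΦdiff hΨpos hφinc hCpos ?_
      hab hw hw0 hfin hlam⟩
  intro s hs
  have hsΨ : 0 < s * Ψ s := mul_pos hs.1 (hΨpos s hs)
  rcases le_total s₀ s with h | h
  · have h1 : c ≤ s * Ψ s := hφinc hs₀mem hs h
    have h2 : 1 + Φ 1 ≤ (1 + D + E) * (s * Ψ s) := by
      calc 1 + Φ 1 = E * c := by rw [hE, div_mul_cancel₀ _ hcpos.ne']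
        _ ≤ _ := mul_le_mul (by linarith) h1 hcpos.le hCpos.le
    set v := ((1 + D + E) * (s * Ψ s))⁻¹ with hv
    have hvpos : 0 < v := by positivity
    have hv1 : v * (1 + Φ 1) ≤ 1 := by
      rw [hv, inv_mul_le_iff₀ (by positivity), mul_one]
      exact h2
    have h3 : Φ (v * 1) ≤ v * Φ 1 :=
      hΦconv.map_mul_le_mul hΦ0 zero_le_one hvpos.le (by nlinarith)
    rw [mul_one] at h3
    have h4 : 1 ≤ s⁻¹ := (one_le_inv₀ hs.1).2 hs.2
    linarith
  · obtain ⟨T, hT0, hT⟩ :=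
      ((eventually_ge_atTop t₀).and (hσ0.eventually (gt_mem_nhds hs.1))).exists
    obtain ⟨t, ht, rfl⟩ := intermediate_value_Icc' hT0
      (hσcont.mono Set.Icc_subset_Ici_self) ⟨hT.le, h⟩
    have ht' : t₀ ≤ t := ht.1
    have htpos : 0 < t := ht₀pos.trans_le ht'
    have hρpos : 0 < ρ t := one_pos.trans_le (hρ1 t ht')
    have hΦ'pos : 0 < Φ' t := hρpos.trans_le (hρΦ' t ht')
    have hΦt : Φ t = t * ρ t := hΦρ t ht'
    have hΦpos : 0 < Φ t := hΦt ▸ mul_pos htpos hρpos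
    have hΦge : t₀ ≤ Φ t := hΦt ▸ ht'.trans (le_mul_of_one_le_right htpos.le (hρ1 t ht'))
    have harg : ((1 + D + E) * ((Φ t * Φ' t)⁻¹ * Ψ ((Φ t * Φ' t)⁻¹)))⁻¹
        = (1 + D + E)⁻¹ * Φ t := by
      rw [hΨagree t ht']
      field_simp
    simp only [harg, inv_inv]
    calc Φ ((1 + D + E)⁻¹ * Φ t) ≤ (1 + D + E)⁻¹ * Φ (Φ t) :=
          hΦconv.map_mul_le_mul hΦ0 hΦpos.le (by positivity)
            (inv_le_one_of_one_le₀ (by linarith))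
      _ = (1 + D + E)⁻¹ * (Φ t * ρ (t * ρ t)) := by rw [hΦρ _ hΦge, hΦt]
      _ ≤ (1 + D + E)⁻¹ * (Φ t * ((1 + D + E) * Φ' t)) := by
          gcongr
          calc ρ (t * ρ t) ≤ D * ρ t := hDρ t ht'
            _ ≤ (1 + D + E) * Φ' t :=
              mul_le_mul (by linarith) (hρΦ' t ht') hρpos.le hCpos.le
      _ = Φ t * Φ' t := by field_simp
end

section
/- Let x₀ ∈ ℝ and let r : [x₀,∞) → (0,∞) be differentiable and increasing with lim_{x→∞} r(x) = ∞, such that r' is decreasing on [x₀,∞) and lim_{x→∞} r'(x)·r(x) = 0. Then for every constant c₀ ≥ 0 one has x − 2r(x) − c₀ ≥ x₀ for all sufficiently large x, and lim_{x→∞} ( r(x) − r(x − 2r(x) − c₀) ) = 0; in particular the difference r(x) − r(x − 2r(x) − c₀) is bounded for large x. -/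
open Filter

/-- A function with antitone derivative lies below its tangent lines to the right. -/
lemma sub_le_mul_sub_of_antitoneOn_deriv {x₀ : ℝ} {r r' : ℝ → ℝ}
    (hderiv : ∀ x ∈ Set.Ici x₀, HasDerivWithinAt r (r' x) (Set.Ici x₀) x)
    (hr'dec : AntitoneOn r' (Set.Ici x₀)) {a b : ℝ} (ha : x₀ ≤ a) (hab : a ≤ b) :
    r b - r a ≤ r' a * (b - a) := by
  rcases hab.eq_or_lt with rfl | hlt
  · simp
  obtain ⟨c, hc, hslope⟩ := exists_hasDerivAt_eq_slope r r' hlt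
    (fun x hx => ((hderiv x (ha.trans hx.1)).continuousWithinAt).mono
      fun z hz => ha.trans hz.1)
    (fun x hx => (hderiv x (ha.trans hx.1.le)).hasDerivAt (Ici_mem_nhds (ha.trans_lt hx.1)))
  have hle : r' c ≤ r' a := hr'dec ha (ha.trans hc.1.le) hc.1.le
  rwa [hslope, div_le_iff₀ (sub_pos.2 hlt)] at hle

/-- the key step (1.11). If `r : [x₀,∞) → (0,∞)` is differentiable and
increasing with `r(x) → ∞`, `r'` decreasing and `r'(x)·r(x) → 0`, then for every
`c₀ ≥ 0` the point `x − 2r(x) − c₀` eventually lies in `[x₀,∞)`,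
`r(x) − r(x − 2r(x) − c₀) → 0` as `x → ∞`, and in particular this difference is
bounded for large `x`. -/
theorem statement3 (x₀ : ℝ) (r r' : ℝ → ℝ)
    (hrpos : ∀ x, x₀ ≤ x → 0 < r x)
    (hderiv : ∀ x ∈ Set.Ici x₀, HasDerivWithinAt r (r' x) (Set.Ici x₀) x)
    (hmono : MonotoneOn r (Set.Ici x₀))
    (htop : Tendsto r atTop atTop)
    (hr'dec : AntitoneOn r' (Set.Ici x₀))
    (hlim : Tendsto (fun x => r' x * r x) atTop (nhds 0)) :
    ∀ c₀ : ℝ, 0 ≤ c₀ →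
      (∀ᶠ x in atTop, x₀ ≤ x - 2 * r x - c₀) ∧
      Tendsto (fun x => r x - r (x - 2 * r x - c₀)) atTop (nhds 0) ∧
      ∃ C : ℝ, ∀ᶠ x in atTop, r x - r (x - 2 * r x - c₀) ≤ C := by
  intro c₀ hc₀
  have hnonneg : ∀ x, x₀ ≤ x → 0 ≤ r' x := fun x hx => by
    rw [← (hderiv x hx).derivWithin (uniqueDiffOn_Ici x₀ x hx)]
    exact hmono.derivWithin_nonneg
  have htangent : ∀ a b, x₀ ≤ a → a ≤ b → r b - r a ≤ r' a * (b - a) := fun a b =>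
    sub_le_mul_sub_of_antitoneOn_deriv hderiv hr'dec
  have hr'lim : Tendsto r' atTop (nhds 0) := by
    refine tendsto_of_tendsto_of_tendsto_of_le_of_le' tendsto_const_nhds hlim ?_ ?_
    · filter_upwards [eventually_ge_atTop x₀] with x hx using hnonneg x hx
    · filter_upwards [eventually_ge_atTop x₀, htop.eventually_ge_atTop 1] with x hx h1
      exact le_mul_of_one_le_right (hnonneg x hx) h1
  have hr'small : ∀ᶠ y in atTop, r' y ≤ 1 / 4 := hr'lim.eventually_le_const (by norm_num)
  have hytop : Tendsto (fun x => x - 2 * r x - c₀) atTop atTop := by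
    obtain ⟨a, hasmall, ha⟩ := (hr'small.and (eventually_ge_atTop x₀)).exists
    have hlin : Tendsto (fun x : ℝ => 1 / 2 * x + (a / 2 - 2 * r a - c₀)) atTop atTop :=
      tendsto_atTop_add_const_right _ _ (tendsto_id.const_mul_atTop (by norm_num))
    refine tendsto_atTop_mono' _ ?_ hlin
    filter_upwards [eventually_ge_atTop a] with x hx
    have := htangent a x ha hx
    have := mul_le_mul_of_nonneg_right hasmall (sub_nonneg.2 hx)
    linarith
  have hybase : ∀ᶠ x in atTop, x₀ ≤ x - 2 * r x - c₀ := hytop.eventually_ge_atTop x₀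
  have hdiff : Tendsto (fun x => r x - r (x - 2 * r x - c₀)) atTop (nhds 0) := by
    have hbound : Tendsto (fun y => 4 * (r' y * r y) + 2 * c₀ * r' y) atTop (nhds 0) := by
      simpa using (hlim.const_mul 4).add (hr'lim.const_mul (2 * c₀))
    refine tendsto_of_tendsto_of_tendsto_of_le_of_le' tendsto_const_nhds
      (hbound.comp hytop) ?_ ?_
    · filter_upwards [hybase, eventually_ge_atTop x₀] with x hy hx
      exact sub_nonneg.2 (hmono hy hx (by linarith [hrpos x hx]))
    · filter_upwards [hybase, eventually_ge_atTop x₀, hytop.eventually hr'small]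
        with x hy hx hsmall
      have hyx : x - 2 * r x - c₀ ≤ x := by linarith [hrpos x hx]
      have htan := htangent _ x hy hyx
      have hd : 0 ≤ r x - r (x - 2 * r x - c₀) := sub_nonneg.2 (hmono hy hx hyx)
      simp only [Function.comp_apply]
      rw [show x - (x - 2 * r x - c₀) = 2 * r x + c₀ by ring] at htan
      have := mul_le_mul_of_nonneg_right hsmall hd
      linarith
  exact ⟨hybase, hdiff, 1, hdiff.eventually_le_const one_pos⟩
end

section
/- Let Ψ : (0,1] → (0,∞) be decreasing such that s ↦ sΨ(s) is increasing on (0,1]. Then for all measurable N₁, N₂ : [0,∞) → [0,1] and every θ ∈ [0,1], n_Ψ(θN₁ + (1−θ)N₂) ≤ 2·n_Ψ((N₁+N₂)/2), where n_Ψ(N) := ∫₀^∞ N(t)Ψ(N(t)) dt with the integrand taken to be 0 where N(t) = 0. In particular (the pointwise inequality (3.10)): for s₁, s₂ ∈ [0,1] with s₁ + s₂ ≤ 1, ((s₁+s₂)/2)·Ψ((s₁+s₂)/2) ≥ (1/2)·s₁Ψ(s₁). -/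
open MeasureTheory

/-- If `Ψ` is positive and decreasing and `φ(s) = sΨ(s)` (with `φ(0) = 0`) is increasing on `(0,1]`,
then `φ(x) ≤ 2φ(y)` whenever `x ≤ 2y`. -/
theorem mul_le_two_mul_of_le_two_mul {Ψ : ℝ → ℝ}
    (hΨpos : ∀ s ∈ Set.Ioc (0:ℝ) 1, 0 < Ψ s)
    (hΨdec : AntitoneOn Ψ (Set.Ioc (0:ℝ) 1))
    (hφinc : MonotoneOn (fun s => s * Ψ s) (Set.Ioc (0:ℝ) 1))
    {x y : ℝ} (hx : x ∈ Set.Icc (0:ℝ) 1) (hy : y ∈ Set.Icc (0:ℝ) 1) (hxy : x ≤ 2 * y) :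
    (if x = 0 then 0 else x * Ψ x) ≤ 2 * (if y = 0 then 0 else y * Ψ y) := by
  obtain rfl | hy0 := hy.1.eq_or_lt
  · simp [le_antisymm (by simpa using hxy) hx.1]
  have hyI : y ∈ Set.Ioc (0:ℝ) 1 := ⟨hy0, hy.2⟩
  have hφy : 0 < y * Ψ y := mul_pos hy0 (hΨpos y hyI)
  rw [if_neg hy0.ne']
  obtain rfl | hx0 := hx.1.eq_or_lt
  · simpa using hφy.le
  have hxI : x ∈ Set.Ioc (0:ℝ) 1 := ⟨hx0, hx.2⟩
  rw [if_neg hx0.ne']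
  obtain hle | hle := le_total x y
  · have : x * Ψ x ≤ y * Ψ y := hφinc hxI hyI hle
    linarith
  · calc x * Ψ x ≤ x * Ψ y := mul_le_mul_of_nonneg_left (hΨdec hyI hxI hle) hx.1
      _ ≤ 2 * y * Ψ y := mul_le_mul_of_nonneg_right hxy (hΨpos y hyI).le
      _ = 2 * (y * Ψ y) := mul_assoc _ _ _

/-- for `Ψ : (0,1] → (0,∞)` decreasing with `s ↦ sΨ(s)` increasing, the
functional `n_Ψ(N) = ∫₀^∞ N·Ψ(N)` satisfies `n_Ψ(θN₁+(1−θ)N₂) ≤ 2·n_Ψ((N₁+N₂)/2)`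
for measurable `N₁, N₂ : [0,∞) → [0,1]` and `θ ∈ [0,1]`; in particular the pointwise
inequality (3.10) holds: for `s₁, s₂ ∈ [0,1]` with `s₁ + s₂ ≤ 1`,
`((s₁+s₂)/2)·Ψ((s₁+s₂)/2) ≥ (1/2)·s₁Ψ(s₁)` (terms taken to be `0` at the origin). -/
theorem statement5 (Ψ : ℝ → ℝ)
    (hΨpos : ∀ s ∈ Set.Ioc (0:ℝ) 1, 0 < Ψ s)
    (hΨdec : AntitoneOn Ψ (Set.Ioc (0:ℝ) 1))
    (hφinc : MonotoneOn (fun s => s * Ψ s) (Set.Ioc (0:ℝ) 1)) :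
    (∀ N₁ N₂ : ℝ → ℝ, Measurable N₁ → Measurable N₂ →
      (∀ t, N₁ t ∈ Set.Icc (0:ℝ) 1) → (∀ t, N₂ t ∈ Set.Icc (0:ℝ) 1) →
      ∀ θ ∈ Set.Icc (0:ℝ) 1,
        (∫⁻ t in Set.Ioi (0:ℝ), ENNReal.ofReal
            (if θ * N₁ t + (1 - θ) * N₂ t = 0 then 0
             else (θ * N₁ t + (1 - θ) * N₂ t) * Ψ (θ * N₁ t + (1 - θ) * N₂ t))) ≤
          2 * ∫⁻ t in Set.Ioi (0:ℝ), ENNReal.ofReal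
            (if (N₁ t + N₂ t) / 2 = 0 then 0
             else ((N₁ t + N₂ t) / 2) * Ψ ((N₁ t + N₂ t) / 2))) ∧
    (∀ s₁ ∈ Set.Icc (0:ℝ) 1, ∀ s₂ ∈ Set.Icc (0:ℝ) 1, s₁ + s₂ ≤ 1 →
      (1 / 2) * (if s₁ = 0 then 0 else s₁ * Ψ s₁) ≤
        (if (s₁ + s₂) / 2 = 0 then 0 else ((s₁ + s₂) / 2) * Ψ ((s₁ + s₂) / 2))) := by
  refine ⟨fun N₁ N₂ _ _ h₁ h₂ θ hθ => ?_, fun s₁ hs₁ s₂ hs₂ hs => ?_⟩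
  · rw [← lintegral_const_mul' 2 _ ENNReal.ofNat_ne_top]
    refine lintegral_mono fun t => ?_
    rw [← ENNReal.ofReal_ofNat 2, ← ENNReal.ofReal_mul zero_le_two]
    obtain ⟨ha, ha'⟩ := h₁ t
    obtain ⟨hb, hb'⟩ := h₂ t
    refine ENNReal.ofReal_le_ofReal
      (mul_le_two_mul_of_le_two_mul hΨpos hΨdec hφinc ?_ ⟨by linarith, by linarith⟩ ?_)
    · exact convex_Icc (0:ℝ) 1 (h₁ t) (h₂ t) hθ.1 (sub_nonneg.2 hθ.2) (by ring)
    · nlinarith [mul_nonneg (sub_nonneg.2 hθ.2) ha, mul_nonneg hθ.1 hb]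
  · have h := mul_le_two_mul_of_le_two_mul hΨpos hΨdec hφinc hs₁
      (y := (s₁ + s₂) / 2) ⟨by linarith [hs₁.1, hs₂.1], by linarith⟩ (by linarith [hs₂.1])
    linarith
end

section
/- Let n ≥ 1, let α₁,…,αₙ ≥ 0 with Σ_{k=1}^n α_k = 1, and let x₁,…,xₙ ∈ ℝ satisfy Σ_{k=1}^n α_k x_k = 0. Then there exist β₁,…,βₙ ∈ ℝ with |β_k| ≤ 1 for every k, Σ_{k=1}^n α_k β_k = 0, and Σ_{k=1}^n α_k β_k x_k ≥ (1/2)·Σ_{k=1}^n α_k |x_k|. -/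
/-- duality step. If `α` is a probability weight and `x` has weighted mean
zero, then there is a mean-zero `β` with `|β_k| ≤ 1` whose pairing with `x` attains at
least half of the weighted `ℓ¹` norm of `x`. -/
theorem statement8 (n : ℕ) (hn : 1 ≤ n) (α x : Fin n → ℝ)
    (hα : ∀ k, 0 ≤ α k) (hαsum : ∑ k, α k = 1) (hx : ∑ k, α k * x k = 0) :
    ∃ β : Fin n → ℝ, (∀ k, |β k| ≤ 1) ∧ (∑ k, α k * β k = 0) ∧
      (1 / 2) * ∑ k, α k * |x k| ≤ ∑ k, α k * β k * x k := by
  obtain ⟨s, hs, hsx⟩ : ∃ s : Fin n → ℝ, (∀ k, |s k| ≤ 1) ∧ ∀ k, s k * x k = |x k| := by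
    refine ⟨fun k => if 0 ≤ x k then 1 else -1, fun k => ?_, fun k => ?_⟩
    · dsimp only
      split_ifs <;> simp
    · dsimp only
      split_ifs with h
      · rw [one_mul, abs_of_nonneg h]
      · rw [neg_one_mul, abs_of_neg (not_le.mp h)]
  obtain ⟨m, hm⟩ : ∃ m, m = ∑ k, α k * s k := ⟨_, rfl⟩
  have hm_abs : |m| ≤ 1 := by
    calc |m| ≤ ∑ k, |α k * s k| := hm ▸ Finset.abs_sum_le_sum_abs _ _
      _ ≤ ∑ k, α k := Finset.sum_le_sum fun k _ => by
        rw [abs_mul, abs_of_nonneg (hα k)]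
        exact mul_le_of_le_one_right (hα k) (hs k)
      _ = 1 := hαsum
  refine ⟨fun k => (s k - m) / 2, fun k => ?_, ?_, ?_⟩
  · have h := abs_le.mp (hs k)
    have h' := abs_le.mp hm_abs
    exact abs_le.mpr ⟨by linarith, by linarith⟩
  · calc ∑ k, α k * ((s k - m) / 2) = ∑ k, (1 / 2 * (α k * s k) - m / 2 * α k) :=
          Finset.sum_congr rfl fun k _ => by ring
      _ = 0 := by
        rw [Finset.sum_sub_distrib, ← Finset.mul_sum, ← Finset.mul_sum, ← hm, hαsum]
        ring
  · apply le_of_eq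
    symm
    calc ∑ k, α k * ((s k - m) / 2) * x k
        = ∑ k, (1 / 2 * (α k * |x k|) - m / 2 * (α k * x k)) :=
          Finset.sum_congr rfl fun k _ => by rw [← hsx k]; ring
      _ = 1 / 2 * ∑ k, α k * |x k| := by
        rw [Finset.sum_sub_distrib, ← Finset.mul_sum, ← Finset.mul_sum, hx]
        ring
end

section
/- Let Ψ : (0,1] → (0,∞) be decreasing and differentiable such that φ(s) := sΨ(s) is increasing on (0,1] and ∫₀¹ ds/φ(s) < ∞. For A ∈ [1,2] and N ∈ [0,1] set T(A, N) := N·∫₀^{N/A} ds/φ(s). Then T is convex on the rectangle [1,2]×[0,1], and for every A ∈ [1,2] and N ∈ (0,1], the partial derivative satisfies −∂T/∂A (A, N) = N²/(A²·φ(N/A)) ≥ (1/4)·N²/φ(N). -/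
open MeasureTheory

/-- The auxiliary function `T(A, N) = N·∫₀^{N/A} ds/φ(s)` with `φ(s) = sΨ(s)`. -/
noncomputable def TT (Ψ : ℝ → ℝ) (A N : ℝ) : ℝ :=
  N * ∫ s in Set.Ioo (0:ℝ) (N / A), (s * Ψ s)⁻¹

lemma TT_eq_intervalIntegral (Ψ : ℝ → ℝ) {A N : ℝ} (h : 0 ≤ N / A) :
    TT Ψ A N = N * ∫ s in (0:ℝ)..(N / A), (s * Ψ s)⁻¹ := by
  rw [TT, intervalIntegral.integral_of_le h, integral_Ioc_eq_integral_Ioo]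

/-- The one-sided fundamental theorem of calculus on `[0,1]`, away from the singularity at `0`. -/
lemma hasDerivWithinAt_integral_of_continuousOn_Ioc {f : ℝ → ℝ}
    (hf : ContinuousOn f (Set.Ioc (0:ℝ) 1)) (hint : IntegrableOn f (Set.Icc (0:ℝ) 1))
    {x : ℝ} (hx : x ∈ Set.Ioc (0:ℝ) 1) :
    HasDerivWithinAt (fun u => ∫ s in (0:ℝ)..u, f s) (f x) (Set.Icc (0:ℝ) 1) x := by
  have : Fact (x ∈ Set.Icc (0:ℝ) 1) := ⟨Set.Ioc_subset_Icc_self hx⟩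
  refine intervalIntegral.integral_hasDerivWithinAt_right
    (t := Set.Icc (0:ℝ) 1) ?_ ⟨Set.Icc 0 1, self_mem_nhdsWithin, hint.1⟩ ?_
  · rw [intervalIntegrable_iff_integrableOn_Icc_of_le hx.1.le]
    exact hint.mono_set (Set.Icc_subset_Icc_right hx.2)
  · refine (hf x hx).mono_of_mem_nhdsWithin ?_
    filter_upwards [self_mem_nhdsWithin, nhdsWithin_le_nhds (lt_mem_nhds hx.1)] with y hy hy0
    exact ⟨hy0, hy.2⟩

/-- The perspective `(t, x) ↦ t * h (x / t)` of a convex function is convex on any convex set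
of pairs with `t` positive and `x / t` in the domain of `h`. -/
lemma ConvexOn.perspective {h : ℝ → ℝ} {s : Set ℝ} (hh : ConvexOn ℝ s h) {D : Set (ℝ × ℝ)}
    (hD : Convex ℝ D) (hpos : ∀ q ∈ D, 0 < q.1) (hmem : ∀ q ∈ D, q.2 / q.1 ∈ s) :
    ConvexOn ℝ D (fun q : ℝ × ℝ => q.1 * h (q.2 / q.1)) := by
  refine ⟨hD, ?_⟩
  rintro ⟨t, x⟩ hp ⟨u, y⟩ hq a b ha hb hab
  have ht : 0 < t := hpos _ hp
  have hu : 0 < u := hpos _ hq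
  have hT : 0 < a * t + b * u := by simpa using hpos _ (hD hp hq ha hb hab)
  have key := hh.2 (hmem _ hp) (hmem _ hq)
    (show 0 ≤ a * t / (a * t + b * u) by positivity)
    (show 0 ≤ b * u / (a * t + b * u) by positivity) (by field_simp)
  have hcomb : a * t / (a * t + b * u) * (x / t) + b * u / (a * t + b * u) * (y / u)
      = (a * x + b * y) / (a * t + b * u) := by
    field_simp
  simp only [smul_eq_mul, hcomb] at key
  simp only [Prod.smul_mk, Prod.mk_add_mk, smul_eq_mul]
  calc (a * t + b * u) * h ((a * x + b * y) / (a * t + b * u))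
      ≤ (a * t + b * u) * (a * t / (a * t + b * u) * h (x / t)
          + b * u / (a * t + b * u) * h (y / u)) := mul_le_mul_of_nonneg_left key hT.le
    _ = a * (t * h (x / t)) + b * (u * h (y / u)) := by field_simp

lemma continuousOn_mul_inv_Ioc {Ψ : ℝ → ℝ}
    (hpos : ∀ s ∈ Set.Ioc (0:ℝ) 1, 0 < Ψ s) (hcont : ContinuousOn Ψ (Set.Ioc (0:ℝ) 1)) :
    ContinuousOn (fun s => (s * Ψ s)⁻¹) (Set.Ioc (0:ℝ) 1) :=
  (continuousOn_id.mul hcont).inv₀ fun s hs => (mul_pos hs.1 (hpos s hs)).ne'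

/-- If `s ↦ 1 / (s * Ψ s)` is integrable on `[0,1]` and `Ψ` is positive, antitone and continuous
on `(0,1]`, then `x ↦ x * ∫₀ˣ ds / (s * Ψ s)` is convex, its derivative being
`∫₀ˣ ds / (s * Ψ s) + 1 / Ψ x`. -/
lemma convexOn_mul_integral_inv {Ψ : ℝ → ℝ}
    (hpos : ∀ s ∈ Set.Ioc (0:ℝ) 1, 0 < Ψ s) (hcont : ContinuousOn Ψ (Set.Ioc (0:ℝ) 1))
    (hdec : AntitoneOn Ψ (Set.Ioc (0:ℝ) 1))
    (hint : IntegrableOn (fun s => (s * Ψ s)⁻¹) (Set.Icc (0:ℝ) 1)) :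
    ConvexOn ℝ (Set.Icc (0:ℝ) 1) (fun x => x * ∫ s in (0:ℝ)..x, (s * Ψ s)⁻¹) := by
  have hderiv : ∀ x ∈ Set.Ioo (0:ℝ) 1, HasDerivAt (fun x => x * ∫ s in (0:ℝ)..x, (s * Ψ s)⁻¹)
      ((∫ s in (0:ℝ)..x, (s * Ψ s)⁻¹) + (Ψ x)⁻¹) x := by
    intro x hx
    have hF := (hasDerivWithinAt_integral_of_continuousOn_Ioc
      (continuousOn_mul_inv_Ioc hpos hcont) hint
      (Set.Ioo_subset_Ioc_self hx)).hasDerivAt (Icc_mem_nhds hx.1 hx.2)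
    refine ((hasDerivAt_id x).mul hF).congr_deriv ?_
    have := hx.1.ne'
    have := (hpos x (Set.Ioo_subset_Ioc_self hx)).ne'
    simp only [id, one_mul]
    field_simp
  refine MonotoneOn.convexOn_of_deriv (convex_Icc 0 1) ?_ ?_ ?_
  · refine continuousOn_id.mul ?_
    have := intervalIntegral.continuousOn_primitive_interval
      (μ := volume) (f := fun s => (s * Ψ s)⁻¹) (a := 0) (b := 1)
      (by rwa [Set.uIcc_of_le zero_le_one])
    rwa [Set.uIcc_of_le zero_le_one] at this
  · rw [interior_Icc]
    exact fun x hx => (hderiv x hx).differentiableAt.differentiableWithinAt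
  · rw [interior_Icc]
    intro x hx y hy hxy
    rw [(hderiv x hx).deriv, (hderiv y hy).deriv]
    have hx' := Set.Ioo_subset_Ioc_self hx
    have hy' := Set.Ioo_subset_Ioc_self hy
    refine add_le_add ?_ (inv_anti₀ (hpos y hy') (hdec hx' hy' hxy))
    refine intervalIntegral.integral_mono_interval le_rfl hx.1.le hxy ?_ ?_
    · refine (ae_restrict_iff' measurableSet_Ioc).2 (Filter.Eventually.of_forall fun s hs => ?_)
      exact inv_nonneg.2 (mul_pos hs.1 (hpos s ⟨hs.1, hs.2.trans hy.2.le⟩)).le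
    · rw [intervalIntegrable_iff_integrableOn_Icc_of_le hy.1.le]
      exact hint.mono_set (Set.Icc_subset_Icc_right hy.2.le)

/-- `T` is convex on `[1,2]×[0,1]` and satisfies
`−∂T/∂A (A,N) = N²/(A²·φ(N/A)) ≥ (1/4)·N²/φ(N)` for `A ∈ [1,2]`, `N ∈ (0,1]`. -/
theorem statement16 (Ψ : ℝ → ℝ)
    (hΨpos : ∀ s ∈ Set.Ioc (0:ℝ) 1, 0 < Ψ s)
    (hΨdiff : DifferentiableOn ℝ Ψ (Set.Ioc (0:ℝ) 1))
    (hΨdec : AntitoneOn Ψ (Set.Ioc (0:ℝ) 1))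
    (hφinc : MonotoneOn (fun s => s * Ψ s) (Set.Ioc (0:ℝ) 1))
    (hφint : IntegrableOn (fun s => (s * Ψ s)⁻¹) (Set.Ioo (0:ℝ) 1)) :
    ConvexOn ℝ (Set.Icc (1:ℝ) 2 ×ˢ Set.Icc (0:ℝ) 1)
        (fun q : ℝ × ℝ => TT Ψ q.1 q.2) ∧
      ∀ A ∈ Set.Icc (1:ℝ) 2, ∀ Nv ∈ Set.Ioc (0:ℝ) 1,
        HasDerivWithinAt (fun a => TT Ψ a Nv)
            (-(Nv ^ 2 / (A ^ 2 * (Nv / A * Ψ (Nv / A))))) (Set.Icc (1:ℝ) 2) A ∧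
          (1 / 4) * (Nv ^ 2 / (Nv * Ψ Nv)) ≤ Nv ^ 2 / (A ^ 2 * (Nv / A * Ψ (Nv / A))) := by
  have hint : IntegrableOn (fun s => (s * Ψ s)⁻¹) (Set.Icc (0:ℝ) 1) :=
    (integrableOn_Icc_iff_integrableOn_Ioo).2 hφint
  refine ⟨?_, fun A hA N hN => ?_⟩
  · have hD : Convex ℝ (Set.Icc (1:ℝ) 2 ×ˢ Set.Icc (0:ℝ) 1) :=
      (convex_Icc 1 2).prod (convex_Icc 0 1)
    have hpos : ∀ q ∈ Set.Icc (1:ℝ) 2 ×ˢ Set.Icc (0:ℝ) 1, 0 < q.1 :=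
      fun q hq => zero_lt_one.trans_le hq.1.1
    have hmem : ∀ q ∈ Set.Icc (1:ℝ) 2 ×ˢ Set.Icc (0:ℝ) 1, q.2 / q.1 ∈ Set.Icc (0:ℝ) 1 :=
      fun q hq => ⟨div_nonneg hq.2.1 (hpos q hq).le,
        (div_le_one (hpos q hq)).2 (hq.2.2.trans hq.1.1)⟩
    refine ((convexOn_mul_integral_inv hΨpos hΨdiff.continuousOn hΨdec hint).perspective
      hD hpos hmem).congr fun q hq => ?_
    have := (hpos q hq).ne'
    simp only [TT_eq_intervalIntegral Ψ (hmem q hq).1]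
    field_simp
  · have hmaps : ∀ a ∈ Set.Icc (1:ℝ) 2, N / a ∈ Set.Ioc (0:ℝ) 1 := fun a ha =>
      have ha0 : 0 < a := zero_lt_one.trans_le ha.1
      ⟨div_pos hN.1 ha0, (div_le_one ha0).2 (hN.2.trans ha.1)⟩
    have hA0 : 0 < A := zero_lt_one.trans_le hA.1
    have hx := hmaps A hA
    have hΨx := hΨpos _ hx
    have hN0 := hN.1
    constructor
    · have hF := hasDerivWithinAt_integral_of_continuousOn_Ioc
        (continuousOn_mul_inv_Ioc hΨpos hΨdiff.continuousOn) hint hx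
      have hdiv : HasDerivWithinAt (fun a => N / a) (-N / A ^ 2) (Set.Icc (1:ℝ) 2) A := by
        simpa [div_eq_mul_inv] using ((hasDerivAt_inv hA0.ne').const_mul N).hasDerivWithinAt
      have hcomp := (hF.comp A hdiv fun a ha => Set.Ioc_subset_Icc_self (hmaps a ha)).const_mul N
      refine (hcomp.congr_of_mem
        (fun a ha => TT_eq_intervalIntegral Ψ (hmaps a ha).1.le) hA).congr_deriv ?_
      field_simp
    · have hφ : N / A * Ψ (N / A) ≤ N * Ψ N := hφinc hx hN (div_le_self hN0.le hA.1)
      have hφx : 0 < N / A * Ψ (N / A) := mul_pos hx.1 hΨx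
      have hA4 : A ^ 2 ≤ 4 := by nlinarith [hA.2]
      rw [one_div_mul_eq_div, div_div, mul_comm (N * Ψ N)]
      gcongr
end

section
/- Let Ψ : (0,1] → (0,∞) be decreasing and differentiable such that s ↦ sΨ(s) is increasing on (0,1] and ∫₀¹ ds/(sΨ(s)) < ∞. Let N be a distribution function with 0 < ∫₀^∞ N(t) dt and n_Ψ(N) < ∞. Then for all 1 ≤ A ≤ A' ≤ 2, 𝐓(A, N) − 𝐓(A', N) ≥ ((A' − A)/4)·(∫₀^∞ N(t) dt)² / n_Ψ(N). -/
open MeasureTheory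

/-- `n_Ψ(N) = ∫₀^∞ N(t)Ψ(N(t)) dt`, integrand taken to be `0` where `N(t) = 0`. -/
noncomputable def nPsi (Ψ N : ℝ → ℝ) : ℝ :=
  ∫ t in Set.Ioi (0:ℝ), (if N t = 0 then 0 else N t * Ψ (N t))

/-- `𝐓(A, N) = ∫₀^∞ T(A, N(t)) dt` for a distribution function `N`. -/
noncomputable def bigT (Ψ : ℝ → ℝ) (A : ℝ) (N : ℝ → ℝ) : ℝ :=
  ∫ t in Set.Ioi (0:ℝ), TT Ψ A (N t)

/-- A distribution function: decreasing `N : [0,∞) → [0,1]` with `∫₀^∞ N < ∞`. -/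
def IsDistFun (N : ℝ → ℝ) : Prop :=
  AntitoneOn N (Set.Ici 0) ∧ (∀ t, 0 ≤ t → N t ∈ Set.Icc (0:ℝ) 1) ∧
    MeasureTheory.IntegrableOn N (Set.Ioi 0)

/-- `T(A, ·)` is nonnegative, bounded by `x ∫₀¹ ds/φ(s)`, and increasing on `[0, 1]`. -/
lemma TT_bounds_and_monotoneOn {Ψ : ℝ → ℝ} (hΨpos : ∀ s ∈ Set.Ioc (0:ℝ) 1, 0 < Ψ s)
    (hφint : IntegrableOn (fun s => (s * Ψ s)⁻¹) (Set.Ioo (0:ℝ) 1)) {A : ℝ} (hA : 1 ≤ A) :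
    (∀ x ∈ Set.Icc (0:ℝ) 1, 0 ≤ TT Ψ A x ∧
      TT Ψ A x ≤ x * ∫ s in Set.Ioo (0:ℝ) 1, (s * Ψ s)⁻¹) ∧
    MonotoneOn (TT Ψ A) (Set.Icc (0:ℝ) 1) := by
  have hA0 : 0 < A := by linarith
  have hnn : ∀ s ∈ Set.Ioo (0:ℝ) 1, 0 ≤ (s * Ψ s)⁻¹ := fun s hs =>
    inv_nonneg.2 (mul_nonneg hs.1.le (hΨpos s ⟨hs.1, hs.2.le⟩).le)
  have hmono : ∀ a b : ℝ, a ≤ b → b ≤ 1 →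
      ∫ s in Set.Ioo (0:ℝ) a, (s * Ψ s)⁻¹ ≤ ∫ s in Set.Ioo (0:ℝ) b, (s * Ψ s)⁻¹ := by
    intro a b hab hb
    refine setIntegral_mono_set (hφint.mono_set (Set.Ioo_subset_Ioo_right hb)) ?_
      (Set.Ioo_subset_Ioo_right hab).eventuallyLE
    filter_upwards [ae_restrict_mem measurableSet_Ioo] with s hs
    exact hnn s ⟨hs.1, hs.2.trans_le hb⟩
  have hpos : ∀ a : ℝ, a ≤ 1 → 0 ≤ ∫ s in Set.Ioo (0:ℝ) a, (s * Ψ s)⁻¹ := fun a ha =>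
    setIntegral_nonneg measurableSet_Ioo fun s hs => hnn s ⟨hs.1, hs.2.trans_le ha⟩
  have hdiv : ∀ x ∈ Set.Icc (0:ℝ) 1, x / A ≤ 1 := fun x hx =>
    (div_le_one hA0).2 (hx.2.trans hA)
  refine ⟨fun x hx => ⟨mul_nonneg hx.1 (hpos _ (hdiv x hx)),
    mul_le_mul_of_nonneg_left (hmono _ _ (hdiv x hx) le_rfl) hx.1⟩, fun x hx y hy hxy => ?_⟩
  exact mul_le_mul hxy (hmono _ _ (div_le_div_of_nonneg_right hxy hA0.le) (hdiv y hy))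
    (hpos _ (hdiv x hx)) hy.1

lemma integrableOn_TT_comp {Ψ : ℝ → ℝ} (hΨpos : ∀ s ∈ Set.Ioc (0:ℝ) 1, 0 < Ψ s)
    (hφint : IntegrableOn (fun s => (s * Ψ s)⁻¹) (Set.Ioo (0:ℝ) 1)) {N : ℝ → ℝ}
    (hN : IsDistFun N) {A : ℝ} (hA : 1 ≤ A) :
    IntegrableOn (fun t => TT Ψ A (N t)) (Set.Ioi 0) := by
  obtain ⟨hanti, hmem, hint⟩ := hN
  obtain ⟨hbound, hmono⟩ := TT_bounds_and_monotoneOn hΨpos hφint hA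
  have hcomp : AntitoneOn (fun t => TT Ψ A (N t)) (Set.Ioi 0) := fun s hs t ht hst =>
    hmono (hmem t (le_of_lt ht)) (hmem s (le_of_lt hs))
      (hanti (Set.mem_Ici.2 (le_of_lt hs)) (Set.mem_Ici.2 (le_of_lt ht)) hst)
  refine Integrable.mono' (hint.mul_const (∫ s in Set.Ioo (0:ℝ) 1, (s * Ψ s)⁻¹))
    (aemeasurable_restrict_of_antitoneOn measurableSet_Ioi hcomp).aestronglyMeasurable ?_
  filter_upwards [ae_restrict_mem measurableSet_Ioi] with t ht
  obtain ⟨h0, h1⟩ := hbound (N t) (hmem t (le_of_lt ht))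
  rwa [Real.norm_of_nonneg h0]

/-- The finite-difference form of `-∂T/∂A ≥ x / (4 Ψ(x))`. -/
lemma div_le_TT_sub_TT {Ψ : ℝ → ℝ} (hΨpos : ∀ s ∈ Set.Ioc (0:ℝ) 1, 0 < Ψ s)
    (hφinc : MonotoneOn (fun s => s * Ψ s) (Set.Ioc (0:ℝ) 1))
    (hφint : IntegrableOn (fun s => (s * Ψ s)⁻¹) (Set.Ioo (0:ℝ) 1))
    {A A' : ℝ} (hA : 1 ≤ A) (hAA' : A ≤ A') (hA' : A' ≤ 2) {x : ℝ} (hx : x ∈ Set.Ioc (0:ℝ) 1) :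
    (A' - A) / 4 * (x / Ψ x) ≤ TT Ψ A x - TT Ψ A' x := by
  have hA0 : 0 < A := by linarith
  have hA'0 : 0 < A' := by linarith
  have hx0 : 0 < x := hx.1
  have hΨ := hΨpos x hx
  have hb : 0 < x / A' := div_pos hx0 hA'0
  have hba : x / A' ≤ x / A := div_le_div_of_nonneg_left hx0.le hA0 hAA'
  have hax : x / A ≤ x := div_le_self hx0.le hA
  have hi : IntegrableOn (fun s => (s * Ψ s)⁻¹) (Set.Ioo 0 (x / A)) :=
    hφint.mono_set (Set.Ioo_subset_Ioo_right (hax.trans hx.2))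
  have hsub : Set.Ico (x / A') (x / A) ⊆ Set.Ioo 0 (x / A) := fun s hs =>
    ⟨hb.trans_le hs.1, hs.2⟩
  have hsplit : ∫ s in Set.Ioo (0:ℝ) (x / A), (s * Ψ s)⁻¹ =
      (∫ s in Set.Ioo (0:ℝ) (x / A'), (s * Ψ s)⁻¹) +
        ∫ s in Set.Ico (x / A') (x / A), (s * Ψ s)⁻¹ := by
    rw [← setIntegral_union _ measurableSet_Ico (hi.mono_set (Set.Ioo_subset_Ioo_right hba))
      (hi.mono_set hsub), Set.Ioo_union_Ico_eq_Ioo hb hba]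
    exact Set.disjoint_left.2 fun s hs hs' => hs.2.not_ge hs'.1
  have hlow : (x / A - x / A') * (x * Ψ x)⁻¹ ≤
      ∫ s in Set.Ico (x / A') (x / A), (s * Ψ s)⁻¹ := by
    have h : ∫ _ in Set.Ico (x / A') (x / A), (x * Ψ x)⁻¹ ≤
        ∫ s in Set.Ico (x / A') (x / A), (s * Ψ s)⁻¹ := by
      refine setIntegral_mono_on (integrableOn_const (by simp)) (hi.mono_set hsub) measurableSet_Ico fun s hs => ?_
      have hs0 : 0 < s := hb.trans_le hs.1
      have hsx : s ≤ x := hs.2.le.trans hax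
      have hs1 : s ∈ Set.Ioc (0:ℝ) 1 := ⟨hs0, hsx.trans hx.2⟩
      exact inv_anti₀ (mul_pos hs0 (hΨpos s hs1)) (hφinc hs1 hx hsx)
    rwa [setIntegral_const, Real.volume_real_Ico_of_le hba, smul_eq_mul] at h
  have hAA4 : A * A' ≤ 4 := by nlinarith
  calc (A' - A) / 4 * (x / Ψ x) ≤ (A' - A) / (A * A') * (x / Ψ x) := by
        gcongr
    _ = x * ((x / A - x / A') * (x * Ψ x)⁻¹) := by field_simp
    _ ≤ x * ∫ s in Set.Ico (x / A') (x / A), (s * Ψ s)⁻¹ := by gcongr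
    _ = TT Ψ A x - TT Ψ A' x := by rw [TT, TT, hsplit]; ring

/-- the finite-difference form of `−∂𝐓/∂A ≥ (1/4)·(∫N)²/n_Ψ(N)`. -/
theorem statement19 (Ψ : ℝ → ℝ)
    (hΨpos : ∀ s ∈ Set.Ioc (0:ℝ) 1, 0 < Ψ s)
    (hΨdiff : DifferentiableOn ℝ Ψ (Set.Ioc (0:ℝ) 1))
    (hΨdec : AntitoneOn Ψ (Set.Ioc (0:ℝ) 1))
    (hφinc : MonotoneOn (fun s => s * Ψ s) (Set.Ioc (0:ℝ) 1))
    (hφint : IntegrableOn (fun s => (s * Ψ s)⁻¹) (Set.Ioo (0:ℝ) 1))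
    (N : ℝ → ℝ) (hN : IsDistFun N)
    (hNpos : 0 < ∫ t in Set.Ioi (0:ℝ), N t)
    (hnfin : IntegrableOn (fun t => if N t = 0 then 0 else N t * Ψ (N t)) (Set.Ioi 0))
    (A A' : ℝ) (hA : 1 ≤ A) (hAA' : A ≤ A') (hA' : A' ≤ 2) :
    (A' - A) / 4 * (∫ t in Set.Ioi (0:ℝ), N t) ^ 2 / nPsi Ψ N ≤
      bigT Ψ A N - bigT Ψ A' N := by
  obtain ⟨-, hmem, hint⟩ := id hN
  set I := ∫ t in Set.Ioi (0:ℝ), N t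
  set c := I / nPsi Ψ N with hc
  have hiA := integrableOn_TT_comp hΨpos hφint hN hA
  have hiA' := integrableOn_TT_comp hΨpos hφint hN (hA.trans hAA')
  have hd : 0 ≤ (A' - A) / 4 := by linarith
  have hpt : ∀ t ∈ Set.Ioi (0:ℝ),
      (A' - A) / 4 * (2 * c * N t - c ^ 2 * (if N t = 0 then 0 else N t * Ψ (N t))) ≤
        TT Ψ A (N t) - TT Ψ A' (N t) := by
    intro t ht
    have hNt := hmem t (le_of_lt ht)
    by_cases h0 : N t = 0
    · simp [h0, TT]
    have hx : N t ∈ Set.Ioc (0:ℝ) 1 := ⟨lt_of_le_of_ne hNt.1 (Ne.symm h0), hNt.2⟩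
    have hΨ := hΨpos _ hx
    refine le_trans ?_ (div_le_TT_sub_TT hΨpos hφinc hφint hA hAA' hA' hx)
    refine mul_le_mul_of_nonneg_left ?_ hd
    rw [if_neg h0, le_div_iff₀ hΨ]
    nlinarith [mul_nonneg hx.1.le (sq_nonneg (c * Ψ (N t) - 1))]
  have hmain := setIntegral_mono_on
    (((hint.const_mul (2 * c)).sub (hnfin.const_mul (c ^ 2))).const_mul ((A' - A) / 4))
    (hiA.sub hiA') measurableSet_Ioi hpt
  simp only [Pi.sub_apply] at hmain
  rw [integral_const_mul, integral_sub (hint.const_mul (2 * c)) (hnfin.const_mul (c ^ 2)),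
    integral_const_mul, integral_const_mul, integral_sub hiA hiA'] at hmain
  change (A' - A) / 4 * (2 * c * I - c ^ 2 * nPsi Ψ N) ≤ bigT Ψ A N - bigT Ψ A' N at hmain
  refine le_trans (le_of_eq ?_) hmain
  rw [hc]
  by_cases hn : nPsi Ψ N = 0
  · simp [hn]
  · field_simp
    ring
end
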